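/- arXiv:2412.10394 — 2 statements merged into one kernel-verified Lean document; each statement's English description precedes it below -/
import Mathlib

section
/- For every positive integer n, the number of maximal chains of the poset NC_{n+1} of noncrossing partitions of {1, …, n+1}, ordered by refinement, equals (n+1)^{n-1}. -/
/-- A collection of blocks `C` (a partition of `Fin m` in the sense of
`Setoid.IsPartition`) is noncrossing if there do not exist `a < b < c < d` with
`a, c` in one block and `b, d` in a different block. -/
def Noncrossing {m : ℕ} (C : Set (Set (Fin m))) : Prop :=
  ∀ B ∈ C, ∀ B' ∈ C, ∀ a b c d : Fin m,
    a < b → b < c → c < d → a ∈ B → c ∈ B → b ∈ B' → d ∈ B' → B = B'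

/-- The set `NC_m` of noncrossing partitions of `{1, …, m}`. -/
def NC (m : ℕ) : Type :=
  {C : Set (Set (Fin m)) // Setoid.IsPartition C ∧ Noncrossing C}

/-- The refinement order on noncrossing partitions: `π ≤ σ` iff every block of `π` is
contained in a block of `σ`. -/
def Refines {m : ℕ} (π σ : NC m) : Prop :=
  ∀ B ∈ π.1, ∃ B' ∈ σ.1, B ⊆ B'


open Finset in
theorem nc_inner_sum (l : ℕ) : ∑ i ∈ Icc 1 l, (l.choose i : ℚ) * (-1) ^ (l - i) * (i : ℚ) ^ (l - 1)
    = if l = 1 then 1 else 0 := by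
  rcases Nat.lt_or_ge l 2 with h | h
  · interval_cases l <;> simp
  · rw [if_neg (by omega)]
    have h1 := congrFun (fwdDiff_iter_pow_eq_zero_of_lt (R := ℚ) (show l - 1 < l by omega)) 0
    rw [fwdDiff_iter_eq_sum_shift] at h1
    rw [Finset.sum_range_eq_add_Ico _ (by omega)] at h1
    have h0 : l - 1 ≠ 0 := by omega
    simp only [zero_smul, add_zero, Pi.zero_apply, zero_pow h0, smul_zero, zero_add] at h1
    rw [← h1]
    refine Finset.sum_congr (by ext; simp) fun i _ => ?_
    simp only [zsmul_eq_mul, nsmul_eq_mul, mul_one]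
    push_cast
    ring

theorem nc_choose_swap (k i j : ℕ) :
    k.choose i * (k - i).choose j = k.choose j * (k - j).choose i := by
  have h1 := Nat.choose_mul (n := k) (k := i + j) (s := i) (by omega)
  have h2 := Nat.choose_mul (n := k) (k := i + j) (s := j) (by omega)
  rw [Nat.add_sub_cancel_left] at h1
  rw [Nat.add_sub_cancel] at h2
  rw [← h1, ← h2, Nat.choose_symm_add]

open Finset in
theorem nc_abel (k : ℕ) (hk : 1 ≤ k) :
    ∑ i ∈ Icc 1 k, (k.choose i : ℚ) * (i : ℚ) ^ (i - 1) * ((k - i : ℕ) : ℚ) ^ (k - i) = (k : ℚ) ^ k := by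
  have h1 : ∀ i ∈ Icc 1 k, (k.choose i : ℚ) * (i : ℚ) ^ (i - 1) * ((k - i : ℕ) : ℚ) ^ (k - i)
      = ∑ j ∈ range (k + 1), (k.choose j : ℚ) * (k : ℚ) ^ j *
          (((k - j).choose i : ℚ) * (-1) ^ (k - j - i) * (i : ℚ) ^ (k - j - 1)) := by
    intro i hi
    rw [mem_Icc] at hi
    have e : ((k - i : ℕ) : ℚ) = (k : ℚ) + (-(i : ℚ)) := by
      rw [Nat.cast_sub hi.2]; ring
    rw [e, add_pow, Finset.mul_sum]
    have : ∑ j ∈ range (k - i + 1), (k.choose i : ℚ) * (i : ℚ) ^ (i - 1) *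
        ((k : ℚ) ^ j * (-(i : ℚ)) ^ (k - i - j) * ((k - i).choose j : ℚ)) =
        ∑ j ∈ range (k + 1), (k.choose i : ℚ) * (i : ℚ) ^ (i - 1) *
        ((k : ℚ) ^ j * (-(i : ℚ)) ^ (k - i - j) * ((k - i).choose j : ℚ)) := by
      apply Finset.sum_subset
      · intro j; simp; omega
      · intro j _ hj
        rw [Nat.choose_eq_zero_of_lt (n := k - i) (k := j) (by simp at hj; omega)]
        simp
    rw [this]
    refine Finset.sum_congr rfl fun j hj => ?_
    have hs : (k.choose i : ℚ) * ((k - i).choose j : ℚ) = (k.choose j : ℚ) * ((k - j).choose i : ℚ) := by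
      exact_mod_cast nc_choose_swap k i j
    by_cases hij : i + j ≤ k
    · have e2 : k - j - 1 = (i - 1) + (k - i - j) := by omega
      have e3 : k - j - i = k - i - j := by omega
      rw [e2, e3, pow_add, neg_pow (i : ℚ)]
      linear_combination ((i : ℚ) ^ (i - 1) * k ^ j * (-1) ^ (k - i - j) * (i : ℚ) ^ (k - i - j)) * hs
    · rw [Nat.choose_eq_zero_of_lt (n := k - i) (k := j) (by omega),
        Nat.choose_eq_zero_of_lt (n := k - j) (k := i) (by omega)]
      simp
  rw [Finset.sum_congr rfl h1, Finset.sum_comm]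
  have h2 : ∀ j ∈ range (k + 1), ∑ i ∈ Icc 1 k, (k.choose j : ℚ) * (k : ℚ) ^ j *
          (((k - j).choose i : ℚ) * (-1) ^ (k - j - i) * (i : ℚ) ^ (k - j - 1)) =
        if k - 1 = j then (k : ℚ) ^ k else 0 := by
    intro j hj
    rw [← Finset.mul_sum]
    have : ∑ i ∈ Icc 1 k, (((k - j).choose i : ℚ) * (-1) ^ (k - j - i) * (i : ℚ) ^ (k - j - 1)) =
        ∑ i ∈ Icc 1 (k - j), (((k - j).choose i : ℚ) * (-1) ^ (k - j - i) * (i : ℚ) ^ (k - j - 1)) := by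
      symm
      apply Finset.sum_subset
      · intro i; simp; omega
      · intro i hi hi'
        rw [Nat.choose_eq_zero_of_lt (n := k - j) (k := i) (by simp at hi hi'; omega)]
        simp
    rw [this, nc_inner_sum]
    simp at hj
    by_cases h : k - 1 = j
    · subst h
      rw [if_pos (by omega), if_pos rfl]
      obtain ⟨r, rfl⟩ : ∃ r, k = r + 1 := ⟨k - 1, by omega⟩
      simp [pow_succ]
      ring
    · rw [if_neg (by omega), if_neg h]; simp
  rw [Finset.sum_congr rfl h2, Finset.sum_ite_eq, if_pos (by simp)]

/-- weight of a block -/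
def ncg (k : ℕ) : ℚ := (k : ℚ) ^ (k - 1) / (k.factorial : ℚ)

open Finset in
theorem ncg_rec (k : ℕ) (hk : 1 ≤ k) :
    ∑ i ∈ Icc 1 (k - 1), ((k - i : ℕ) : ℚ) * (ncg i * ncg (k - i)) = ((k - 1 : ℕ) : ℚ) * ncg k := by
  have h := nc_abel k hk
  obtain ⟨r, rfl⟩ : ∃ r, k = r + 1 := ⟨k - 1, by omega⟩
  rw [Finset.sum_Icc_succ_top (by omega)] at h
  have hf : ((r + 1).factorial : ℚ) ≠ 0 := by positivity
  have h2 : ∀ i ∈ Icc 1 r, (((r + 1).choose i : ℕ) : ℚ) * (i : ℚ) ^ (i - 1) * ((r + 1 - i : ℕ) : ℚ) ^ (r + 1 - i)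
     = ((r + 1).factorial : ℚ) * (((r + 1 - i : ℕ) : ℚ) * (ncg i * ncg (r + 1 - i))) := by
    intro i hi
    rw [mem_Icc] at hi
    rw [Nat.cast_choose ℚ (by omega : i ≤ r + 1)]
    obtain ⟨s, hs⟩ : ∃ s, r + 1 - i = s + 1 := ⟨r - i, by omega⟩
    rw [hs]
    unfold ncg
    have : (i.factorial : ℚ) ≠ 0 := by positivity
    have : ((s+1).factorial : ℚ) ≠ 0 := by positivity
    field_simp
    simp [pow_succ]
    ring
  rw [Finset.sum_congr rfl h2, ← Finset.mul_sum] at h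
  simp only [Nat.add_sub_cancel]
  generalize (∑ i ∈ Icc 1 r, (((r + 1 - i : ℕ) : ℚ) * (ncg i * ncg (r + 1 - i)))) = S at h ⊢
  unfold ncg
  field_simp
  simp at h ⊢
  rw [pow_succ] at h
  linear_combination h


def NCQ {α : Type*} [PartialOrder α] (x : α) (s : Set α) : Prop :=
  s ⊆ Set.Iic x ∧ IsChain (· ≤ ·) s ∧ ∀ t : Set α, IsChain (· ≤ ·) t → t ⊆ Set.Iic x → s ⊆ t → s = t

section
variable {α : Type*} [PartialOrder α]

theorem NCQ.mem {x : α} {s : Set α} (h : NCQ x s) : x ∈ s := by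
  have := h.2.2 (insert x s) (h.2.1.insert fun b hb _ => Or.inr (h.1 hb))
    (Set.insert_subset (Set.mem_Iic.2 le_rfl) h.1) (Set.subset_insert _ _)
  rw [this]; exact Set.mem_insert _ _

theorem NCQ.of_min {x : α} (hx : ∀ y, ¬ y < x) (s : Set α) : NCQ x s ↔ s = {x} := by
  have h1 : ∀ t : Set α, t ⊆ Set.Iic x → t ⊆ {x} := by
    intro t ht y hy
    rcases (ht hy : y ≤ x).lt_or_eq with h | h
    · exact absurd h (hx y)
    · exact h
  constructor
  · intro h
    exact Set.Subset.antisymm (h1 _ h.1) (by simpa using h.mem)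
  · rintro rfl
    refine ⟨by simp, by simp [IsChain], fun t _ ht hs => Set.Subset.antisymm hs (h1 t ht)⟩

theorem NCQ.ins {x y : α} (hyx : y ⋖ x) {t : Set α} (h : NCQ y t) : NCQ x (insert x t) := by
  refine ⟨Set.insert_subset (Set.mem_Iic.2 le_rfl) fun z hz => (h.1 hz).trans hyx.1.le,
    h.2.1.insert fun b hb _ => Or.inr ((h.1 hb).trans hyx.1.le), ?_⟩
  intro t' ht' hx hs
  have hyt : y ∈ t' := hs (Set.mem_insert_of_mem _ h.mem)
  have hxt : x ∈ t' := hs (Set.mem_insert _ _)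
  have hxn : x ∉ t := fun hh => absurd (h.1 hh) (not_le_of_gt hyx.1)
  have h1 : t = t' \ {x} := by
    apply h.2.2 _ (ht'.mono Set.sdiff_subset)
    · rintro z ⟨hz, hzx⟩
      have hzx' : z < x := lt_of_le_of_ne (hx hz) hzx
      rcases ht'.total hz hyt with h | h
      · exact h
      · rcases h.lt_or_eq with h | h
        · exact absurd hzx' (hyx.2 h)
        · exact h.symm.le
    · intro z hz
      exact ⟨hs (Set.mem_insert_of_mem _ hz), fun e => hxn (by rw [← (show z = x from e)]; exact hz)⟩
  rw [h1, Set.insert_sdiff_singleton, Set.insert_eq_of_mem hxt]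

theorem NCQ.exists [Finite α] {x : α} (hx : ∃ y, y < x) {s : Set α} (h : NCQ x s) :
    ∃ y, y ⋖ x ∧ ∃ t, NCQ y t ∧ Insert.insert x t = s := by
  have hne : (s \ {x}).Nonempty := by
    by_contra hc
    rw [Set.not_nonempty_iff_eq_empty, Set.sdiff_eq_empty] at hc
    obtain ⟨y, hy⟩ := hx
    have h1 : ({y, x} : Set α) ⊆ Set.Iic x := by
      intro z hz
      rcases hz with rfl | rfl
      · exact hy.le
      · exact le_rfl
    have h2 : IsChain (· ≤ ·) ({y, x} : Set α) := by
      apply IsChain.insert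
      · simp [IsChain]
      · rintro b rfl _
        exact Or.inl hy.le
    have h3 := h.2.2 _ h2 h1 (fun z hz => Or.inr (hc hz))
    have : y ∈ s := by rw [h3]; simp
    exact hy.ne (hc this)
  obtain ⟨y, hy⟩ := (Set.toFinite (s \ {x})).exists_maximal hne
  have hge : ∀ z ∈ s \ {x}, z ≤ y := by
    intro z hz
    rcases h.2.1.total hz.1 hy.1.1 with h' | h'
    · exact h'
    · exact hy.2 hz h'
  have hyx : y < x := lt_of_le_of_ne (h.1 hy.1.1) hy.1.2
  have hs : Insert.insert x (s \ {x}) = s := by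
    rw [Set.insert_sdiff_singleton, Set.insert_eq_of_mem h.mem]
  refine ⟨y, ⟨hyx, ?_⟩, s \ {x}, ⟨hge, h.2.1.mono Set.sdiff_subset, ?_⟩, hs⟩
  · intro z hyz hzx
    have h1 : IsChain (· ≤ ·) (Insert.insert z s) := by
      apply h.2.1.insert
      intro b hb _
      by_cases hbx : b = x
      · subst hbx; exact Or.inl hzx.le
      · exact Or.inr ((hge b ⟨hb, hbx⟩).trans hyz.le)
    have h2 := h.2.2 _ h1 (Set.insert_subset hzx.le h.1) (Set.subset_insert _ _)
    have h3 : z ∈ s := by rw [h2]; simp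
    exact absurd (hge z ⟨h3, hzx.ne⟩) (not_le_of_gt hyz)
  · intro t ht hty hst
    have h1 : IsChain (· ≤ ·) (Insert.insert x t) :=
      ht.insert fun b hb _ => Or.inr ((hty hb).trans hyx.le)
    have h2 := h.2.2 _ h1 (Set.insert_subset (Set.mem_Iic.2 le_rfl) fun z hz => (hty hz).trans hyx.le)
      (by rw [← hs]; exact Set.insert_subset_insert hst)
    have hxn : x ∉ t := fun hh => absurd (hty hh) (not_le_of_gt hyx)
    rw [h2, Set.insert_sdiff_of_mem _ (Set.mem_singleton x), Set.sdiff_singleton_eq_self hxn]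

open Classical in
noncomputable def ncN [Fintype α] (x : α) : ℕ := (Finset.univ.filter (fun s : Set α => NCQ x s)).card

theorem ncN_min [Fintype α] {x : α} (hx : ∀ y, ¬ y < x) : ncN x = 1 := by
  classical
  unfold ncN
  rw [Finset.card_eq_one]
  refine ⟨{x}, ?_⟩
  ext s
  simp [NCQ.of_min hx]

open Classical in
theorem ncN_rec [Fintype α] {x : α} (hx : ∃ y, y < x) :
    ncN x = ∑ y ∈ Finset.univ.filter (fun y => y ⋖ x), ncN y := by
  have h : Finset.univ.filter (fun s : Set α => NCQ x s) =
      (Finset.univ.filter (fun y => y ⋖ x)).biUnion fun y =>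
        (Finset.univ.filter (fun s : Set α => NCQ y s)).image (Insert.insert x) := by
    ext s
    simp only [Finset.mem_filter, Finset.mem_univ, true_and, Finset.mem_biUnion, Finset.mem_image]
    constructor
    · intro h
      obtain ⟨y, hy, t, ht, rfl⟩ := h.exists hx
      exact ⟨y, hy, t, ht, rfl⟩
    · rintro ⟨y, hy, t, ht, rfl⟩
      exact ht.ins hy
  have hkey : ∀ y y' : α, y ⋖ x → y' ⋖ x → ∀ t t' : Set α, NCQ y t → NCQ y' t' →
      Insert.insert x t = Insert.insert x t' → t = t' := by
    intro y y' hy hy' t t' ht ht' he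
    have hxn : x ∉ t := fun hh => absurd (ht.1 hh) (not_le_of_gt hy.1)
    have hxn' : x ∉ t' := fun hh => absurd (ht'.1 hh) (not_le_of_gt hy'.1)
    rw [← Set.insert_sdiff_self_of_notMem hxn, he, Set.insert_sdiff_self_of_notMem hxn']
  unfold ncN
  rw [h, Finset.card_biUnion]
  · refine Finset.sum_congr rfl fun y hy => ?_
    apply Finset.card_image_of_injOn
    intro t ht t' ht' he
    simp at ht ht' hy
    exact hkey y y hy hy t t' ht ht' he
  · intro y hy y' hy' hne
    rw [Function.onFun, Finset.disjoint_left]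
    intro s hs hs'
    simp only [Finset.mem_filter, Finset.mem_univ, true_and, Finset.mem_image] at hs hs' hy hy'
    simp at hy hy'
    obtain ⟨t, ht, rfl⟩ := hs
    obtain ⟨t', ht', he⟩ := hs'
    have := hkey y y' hy hy' t t' ht ht' he.symm
    subst this
    exact hne (le_antisymm (ht'.1 ht.mem) (ht.1 ht'.mem))
end


open Finset in
theorem nc_sum_tail {β : Type*} [LinearOrder β] (h : ℕ → ℚ) (A : Finset β) :
    ∑ s ∈ A, h (A.filter (fun b => s ≤ b)).card = ∑ i ∈ Icc 1 A.card, h i := by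
  induction A using Finset.induction_on_min with
  | empty => simp
  | insert a A ha ih =>
    have hn : a ∉ A := fun hh => lt_irrefl _ (ha a hh)
    rw [Finset.sum_insert hn, Finset.card_insert_of_notMem hn, Finset.sum_Icc_succ_top (by omega), ← ih,
      add_comm]
    congr 1
    · refine Finset.sum_congr rfl fun s hs => ?_
      rw [Finset.filter_insert, if_neg (not_le_of_gt (ha s hs))]
    · rw [Finset.filter_true_of_mem, Finset.card_insert_of_notMem hn]
      intro b hb
      rcases Finset.mem_insert.1 hb with rfl | hb
      · exact le_rfl
      · exact (ha b hb).le

open Finset in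
theorem nc_sum_pairs {β : Type*} [LinearOrder β] (h : ℕ → ℚ) (A : Finset β) :
    ∑ t ∈ A, ∑ s ∈ A.filter (fun s => s ≤ t), h (A.filter (fun b => s ≤ b ∧ b ≤ t)).card =
      ∑ i ∈ Icc 1 A.card, ((A.card + 1 - i : ℕ) : ℚ) * h i := by
  induction A using Finset.induction_on_max with
  | empty => simp
  | insert a A ha ih =>
    have hn : a ∉ A := fun hh => lt_irrefl _ (ha a hh)
    rw [Finset.sum_insert hn]
    have h1 : ∑ s ∈ (insert a A).filter (fun s => s ≤ a),
        h ((insert a A).filter (fun b => s ≤ b ∧ b ≤ a)).card = ∑ i ∈ Icc 1 (A.card + 1), h i := by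
      have hle : ∀ b ∈ insert a A, b ≤ a := by
        intro b hb
        rcases Finset.mem_insert.1 hb with rfl | hb
        · exact le_rfl
        · exact (ha b hb).le
      rw [Finset.filter_true_of_mem hle, ← Finset.card_insert_of_notMem hn, ← nc_sum_tail]
      refine Finset.sum_congr rfl fun s hs => ?_
      congr 2
      exact Finset.filter_congr fun b hb => by simp [hle b hb]
    have h2 : ∑ t ∈ A, ∑ s ∈ (insert a A).filter (fun s => s ≤ t),
        h ((insert a A).filter (fun b => s ≤ b ∧ b ≤ t)).card =
        ∑ t ∈ A, ∑ s ∈ A.filter (fun s => s ≤ t), h (A.filter (fun b => s ≤ b ∧ b ≤ t)).card := by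
      refine Finset.sum_congr rfl fun t ht => ?_
      rw [Finset.filter_insert, if_neg (not_le_of_gt (ha t ht))]
      refine Finset.sum_congr rfl fun s hs => ?_
      rw [Finset.filter_insert, if_neg (fun hh => not_le_of_gt (ha t ht) hh.2)]
    rw [h1, h2, ih, Finset.card_insert_of_notMem hn, Finset.sum_Icc_succ_top (by omega),
      Finset.sum_Icc_succ_top (by omega), add_right_comm, ← Finset.sum_add_distrib]
    congr 1
    · refine Finset.sum_congr rfl fun i hi => ?_
      rw [mem_Icc] at hi
      rw [show A.card + 1 + 1 - i = (A.card + 1 - i) + 1 by omega]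
      push_cast
      ring
    · simp

/-- the admissible lower parts -/
def IsPart {m : ℕ} (B X : Finset (Fin m)) : Prop :=
  X ⊆ B ∧ X.Nonempty ∧ (∃ a ∈ B, ∀ x ∈ X, a < x) ∧ ∀ a ∈ X, ∀ c ∈ X, ∀ b ∈ B, a ≤ b → b ≤ c → b ∈ X

open Classical in
noncomputable def parts {m : ℕ} (B : Finset (Fin m)) : Finset (Finset (Fin m)) :=
  Finset.univ.filter (IsPart B)

open Finset in
theorem sum_parts {m : ℕ} (B : Finset (Fin m)) (hB : B.Nonempty) (h : ℕ → ℚ) :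
    ∑ X ∈ parts B, h X.card = ∑ i ∈ Icc 1 (B.card - 1), ((B.card - i : ℕ) : ℚ) * h i := by
  classical
  set A := B.erase (B.min' hB) with hA
  have hc : A.card + 1 = B.card := Finset.card_erase_add_one (B.min'_mem hB)
  have hAB : ∀ x ∈ A, B.min' hB < x := fun x hx =>
    lt_of_le_of_ne (B.min'_le x (Finset.mem_of_mem_erase hx)) (Finset.ne_of_mem_erase hx).symm
  rw [← hc, Nat.add_sub_cancel, ← nc_sum_pairs h A, Finset.sum_sigma']
  symm
  refine Finset.sum_bij' (fun p _ => A.filter (fun b => p.2 ≤ b ∧ b ≤ p.1))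
    (fun X hX => ⟨X.max' (by simp [parts] at hX; exact hX.2.1), X.min' (by simp [parts] at hX; exact hX.2.1)⟩)
    ?_ ?_ ?_ ?_ ?_
  · rintro ⟨t, s⟩ hp
    simp only [mem_sigma, mem_filter] at hp
    obtain ⟨ht, hs, hst⟩ := hp
    simp only [parts, mem_filter, mem_univ, true_and]
    refine ⟨fun x hx => Finset.mem_of_mem_erase (Finset.mem_filter.1 hx).1, ⟨t, by simp [ht, hst]⟩,
      ⟨_, B.min'_mem hB, fun x hx => hAB x (Finset.mem_filter.1 hx).1⟩, ?_⟩
    intro a ha c hc b hb hab hbc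
    simp only [mem_filter] at ha hc ⊢
    refine ⟨Finset.mem_erase.2 ⟨?_, hb⟩, ha.2.1.trans hab, hbc.trans hc.2.2⟩
    exact ((hAB a ha.1).trans_le hab).ne'
  · intro X hX
    simp only [parts, mem_filter, mem_univ, true_and] at hX
    obtain ⟨h1, h2, ⟨a, ha, hlt⟩, h4⟩ := hX
    have hXA : ∀ x ∈ X, x ∈ A := fun x hx =>
      Finset.mem_erase.2 ⟨((B.min'_le a ha).trans_lt (hlt x hx)).ne', h1 hx⟩
    simp only [mem_sigma, mem_filter]
    exact ⟨hXA _ (X.max'_mem _), hXA _ (X.min'_mem _), X.min'_le _ (X.max'_mem _)⟩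
  · rintro ⟨t, s⟩ hp
    simp only [mem_sigma, mem_filter] at hp
    obtain ⟨ht, hs, hst⟩ := hp
    have e1 : ∀ hh, (A.filter (fun b => s ≤ b ∧ b ≤ t)).max' hh = t := by
      intro hh
      apply le_antisymm
      · apply Finset.max'_le; intro y hy; exact (Finset.mem_filter.1 hy).2.2
      · apply Finset.le_max'; simp [ht, hst]
    have e2 : ∀ hh, (A.filter (fun b => s ≤ b ∧ b ≤ t)).min' hh = s := by
      intro hh
      apply le_antisymm
      · apply Finset.min'_le; simp [hs, hst]
      · apply Finset.le_min'; intro y hy; exact (Finset.mem_filter.1 hy).2.1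
    simp [e1, e2]
  · intro X hX
    simp only [parts, mem_filter, mem_univ, true_and] at hX
    obtain ⟨h1, h2, ⟨a, ha, hlt⟩, h4⟩ := hX
    ext b
    simp only [mem_filter]
    constructor
    · rintro ⟨hb, hl, hr⟩
      exact h4 _ (X.min'_mem h2) _ (X.max'_mem h2) b (Finset.mem_of_mem_erase hb) hl hr
    · intro hb
      exact ⟨Finset.mem_erase.2 ⟨((B.min'_le a ha).trans_lt (hlt b hb)).ne', h1 hb⟩, X.min'_le _ hb, X.le_max' _ hb⟩
  · rintro ⟨t, s⟩ _
    rfl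

/-- Noncrossing partitions with finset blocks. -/
@[ext] structure NCF (m : ℕ) where
  P : Finset (Finset (Fin m))
  ne : ∀ B ∈ P, B.Nonempty
  cover : ∀ a, ∃ B ∈ P, a ∈ B
  disj : ∀ B ∈ P, ∀ B' ∈ P, ∀ a, a ∈ B → a ∈ B' → B = B'
  nc : ∀ B ∈ P, ∀ B' ∈ P, ∀ a b c d : Fin m,
    a < b → b < c → c < d → a ∈ B → c ∈ B → b ∈ B' → d ∈ B' → B = B'

namespace NCF
variable {m : ℕ}

def Ref (P Q : Finset (Finset (Fin m))) : Prop := ∀ B ∈ P, ∃ B' ∈ Q, B ⊆ B'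

theorem ref_sub {π σ : NCF m} (h : Ref π.P σ.P) (h' : Ref σ.P π.P) : π.P ⊆ σ.P := by
  intro B hB
  obtain ⟨B', hB', h1⟩ := h B hB
  obtain ⟨B'', hB'', h2⟩ := h' B' hB'
  obtain ⟨a, ha⟩ := π.ne B hB
  have := π.disj B hB B'' hB'' a ha (h2 (h1 ha))
  subst this
  rwa [Finset.Subset.antisymm h1 h2]

instance : PartialOrder (NCF m) where
  le π σ := Ref π.P σ.P
  le_refl π := fun B hB => ⟨B, hB, Finset.Subset.refl _⟩
  le_trans π σ τ h h' := by
    intro B hB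
    obtain ⟨B', hB', h1⟩ := h B hB
    obtain ⟨B'', hB'', h2⟩ := h' B' hB'
    exact ⟨B'', hB'', h1.trans h2⟩
  le_antisymm π σ h h' := NCF.ext (Finset.Subset.antisymm (ref_sub h h') (ref_sub h' h))

theorem le_def {π σ : NCF m} : π ≤ σ ↔ Ref π.P σ.P := Iff.rfl

noncomputable instance : Fintype (NCF m) :=
  @Fintype.ofFinite _ (Finite.of_injective NCF.P fun _ _ h => NCF.ext h)

def splitP (P : Finset (Finset (Fin m))) (B X : Finset (Fin m)) : Finset (Finset (Fin m)) :=
  insert X (insert (B \ X) (P.erase B))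

theorem mem_splitP {P : Finset (Finset (Fin m))} {B X Z : Finset (Fin m)} :
    Z ∈ splitP P B X ↔ Z = X ∨ Z = B \ X ∨ (Z ≠ B ∧ Z ∈ P) := by
  simp [splitP]

theorem splitP_ref {P : Finset (Finset (Fin m))} {B X : Finset (Fin m)} (hB : B ∈ P) (hX : IsPart B X) :
    Ref (splitP P B X) P := by
  intro Z hZ
  rcases mem_splitP.1 hZ with rfl | rfl | ⟨_, h⟩
  · exact ⟨B, hB, hX.1⟩
  · exact ⟨B, hB, Finset.sdiff_subset⟩
  · exact ⟨Z, h, Finset.Subset.refl _⟩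

theorem X_notMem (π : NCF m) {B X : Finset (Fin m)} (hB : B ∈ π.P) (hX : IsPart B X) : X ∉ π.P := by
  intro h
  obtain ⟨h1, ⟨x, hx⟩, ⟨a, ha, hlt⟩, -⟩ := hX
  have := π.disj X h B hB x hx (h1 hx)
  subst this
  exact lt_irrefl _ (hlt a ha)

theorem BX_notMem (π : NCF m) {B X : Finset (Fin m)} (hB : B ∈ π.P) (hX : IsPart B X) : B \ X ∉ π.P := by
  intro h
  obtain ⟨h1, ⟨x, hx⟩, ⟨a, ha, hlt⟩, -⟩ := hX
  have := π.disj (B \ X) h B hB a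
    (Finset.mem_sdiff.2 ⟨ha, fun h => lt_irrefl _ (hlt a h)⟩) ha
  have hxB := h1 hx
  rw [← this] at hxB
  exact (Finset.mem_sdiff.1 hxB).2 hx

def split (π : NCF m) (B X : Finset (Fin m)) (hB : B ∈ π.P) (hX : IsPart B X) : NCF m where
  P := splitP π.P B X
  ne := by
    intro Z hZ
    rcases mem_splitP.1 hZ with rfl | rfl | ⟨_, h⟩
    · exact hX.2.1
    · obtain ⟨a, ha, hlt⟩ := hX.2.2.1
      exact ⟨a, Finset.mem_sdiff.2 ⟨ha, fun h => lt_irrefl _ (hlt a h)⟩⟩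
    · exact π.ne Z h
  cover := by
    intro a
    obtain ⟨Z, hZ, ha⟩ := π.cover a
    by_cases hZB : Z = B
    · subst hZB
      by_cases haX : a ∈ X
      · exact ⟨X, mem_splitP.2 (Or.inl rfl), haX⟩
      · exact ⟨Z \ X, mem_splitP.2 (Or.inr (Or.inl rfl)), Finset.mem_sdiff.2 ⟨ha, haX⟩⟩
    · exact ⟨Z, mem_splitP.2 (Or.inr (Or.inr ⟨hZB, hZ⟩)), ha⟩
  disj := by
    intro Z hZ Z' hZ' a ha ha'
    have hXB := hX.1
    have hd := π.disj
    rcases mem_splitP.1 hZ with rfl | rfl | ⟨h, h2⟩ <;>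
    rcases mem_splitP.1 hZ' with rfl | rfl | ⟨h', h2'⟩
    · rfl
    · exact absurd ha (Finset.mem_sdiff.1 ha').2
    · exact absurd (π.disj _ h2' B hB a ha' (hXB ha)) h'
    · exact absurd ha' (Finset.mem_sdiff.1 ha).2
    · rfl
    · exact absurd (π.disj _ h2' B hB a ha' (Finset.mem_sdiff.1 ha).1) h'
    · exact absurd (π.disj _ h2 B hB a ha (hXB ha')) h
    · exact absurd (π.disj _ h2 B hB a ha (Finset.mem_sdiff.1 ha').1) h
    · exact π.disj _ h2 _ h2' a ha ha'
  nc := by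
    intro Z hZ Z' hZ' a b c d hab hbc hcd ha hc hb hd
    have hXB := hX.1
    have hconv := hX.2.2.2
    have hn := fun (U : Finset (Fin m)) (hU : U ∈ π.P) (V : Finset (Fin m)) (hV : V ∈ π.P) h1 h2 h3 h4 =>
      π.nc U hU V hV a b c d hab hbc hcd h1 h2 h3 h4
    rcases mem_splitP.1 hZ with rfl | rfl | ⟨h, h2⟩ <;>
    rcases mem_splitP.1 hZ' with rfl | rfl | ⟨h', h2'⟩
    · rfl
    · exact absurd (hconv a ha c hc b (Finset.mem_sdiff.1 hb).1 hab.le hbc.le) (Finset.mem_sdiff.1 hb).2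
    · exact absurd (hn B hB _ h2' (hXB ha) (hXB hc) hb hd).symm h'
    · exact absurd (hconv b hb d hd c (Finset.mem_sdiff.1 hc).1 hbc.le hcd.le) (Finset.mem_sdiff.1 hc).2
    · rfl
    · exact absurd (hn B hB _ h2' (Finset.mem_sdiff.1 ha).1 (Finset.mem_sdiff.1 hc).1 hb hd).symm h'
    · exact absurd (hn _ h2 B hB ha hc (hXB hb) (hXB hd)) h
    · exact absurd (hn _ h2 B hB ha hc (Finset.mem_sdiff.1 hb).1 (Finset.mem_sdiff.1 hd).1) h
    · exact hn _ h2 _ h2' ha hc hb hd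

theorem split_lt (π : NCF m) (B X : Finset (Fin m)) (hB : B ∈ π.P) (hX : IsPart B X) :
    π.split B X hB hX < π := by
  refine lt_of_le_of_ne (splitP_ref hB hX) fun h => ?_
  apply π.X_notMem hB hX
  have : X ∈ splitP π.P B X := mem_splitP.2 (Or.inl rfl)
  rw [← h]
  exact this

theorem exists_split {σ π : NCF m} (h : σ < π) :
    ∃ B ∈ π.P, ∃ X, IsPart B X ∧ Ref σ.P (splitP π.P B X) := by
  have hle := le_def.1 h.le
  obtain ⟨Y0, hY0, hY0n⟩ : ∃ Y ∈ σ.P, Y ∉ π.P := by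
    by_contra hc
    push Not at hc
    apply not_le_of_gt h
    intro B hB
    obtain ⟨a, ha⟩ := π.ne B hB
    obtain ⟨Y, hY, haY⟩ := σ.cover a
    refine ⟨Y, hY, ?_⟩
    rw [π.disj B hB Y (hc Y hY) a ha haY]
  obtain ⟨B, hB, hYB⟩ := hle Y0 hY0
  have hbm := B.min'_mem (π.ne B hB)
  have hbl : ∀ x ∈ B, B.min' (π.ne B hB) ≤ x := fun x hx => B.min'_le x hx
  generalize B.min' (π.ne B hB) = b at hbm hbl
  obtain ⟨Y, hY, hYB, hbY⟩ : ∃ Y ∈ σ.P, Y ⊆ B ∧ b ∉ Y := by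
    by_cases hb : b ∈ Y0
    · obtain ⟨y, hy, hyn⟩ : ∃ y ∈ B, y ∉ Y0 := by
        by_contra hc
        push Not at hc
        exact hY0n (by rwa [Finset.Subset.antisymm hYB hc])
      obtain ⟨Y, hY, hyY⟩ := σ.cover y
      obtain ⟨B', hB', hYB'⟩ := hle Y hY
      have := π.disj B' hB' B hB y (hYB' hyY) hy
      subst this
      refine ⟨Y, hY, hYB', fun hbY => hyn ?_⟩
      rwa [σ.disj Y0 hY0 Y hY b hb hbY]
    · exact ⟨Y0, hY0, hYB, hb⟩
  obtain ⟨p, hp, hpl⟩ : ∃ p ∈ Y, ∀ y ∈ Y, p ≤ y :=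
    ⟨_, Y.min'_mem (σ.ne Y hY), fun y hy => Y.min'_le y hy⟩
  obtain ⟨q, hq, hql⟩ : ∃ q ∈ Y, ∀ y ∈ Y, y ≤ q :=
    ⟨_, Y.max'_mem (σ.ne Y hY), fun y hy => Y.le_max' y hy⟩
  have hbp : b < p := lt_of_le_of_ne (hbl p (hYB hp)) fun e => hbY (by rwa [e])
  have hmem : ∀ x, x ∈ B.filter (fun x => p ≤ x ∧ x ≤ q) ↔ x ∈ B ∧ p ≤ x ∧ x ≤ q := by simp
  generalize B.filter (fun x => p ≤ x ∧ x ≤ q) = X at hmem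
  refine ⟨B, hB, X, ⟨fun x hx => ((hmem x).1 hx).1, ⟨p, (hmem p).2 ⟨hYB hp, le_rfl, hpl q hq⟩⟩,
    ⟨b, hbm, fun x hx => hbp.trans_le ((hmem x).1 hx).2.1⟩, ?_⟩, ?_⟩
  · intro a ha c hc z hz haz hzc
    rw [hmem] at *
    exact ⟨hz, ha.2.1.trans haz, hzc.trans hc.2.2⟩
  · intro Z hZ
    obtain ⟨B', hB', hZB'⟩ := hle Z hZ
    by_cases hBB : B' = B
    · subst hBB
      by_cases hZY : Z = Y
      · subst hZY
        exact ⟨X, mem_splitP.2 (Or.inl rfl), fun x hx => (hmem x).2 ⟨hZB' hx, hpl x hx, hql x hx⟩⟩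
      · have hpZ : p ∉ Z := fun hh => hZY (σ.disj Z hZ Y hY p hh hp)
        have hqZ : q ∉ Z := fun hh => hZY (σ.disj Z hZ Y hY q hh hq)
        by_cases hex : ∃ z ∈ Z, p ≤ z ∧ z ≤ q
        · obtain ⟨z, hz, hpz, hzq⟩ := hex
          have hpz' : p < z := lt_of_le_of_ne hpz fun e => hpZ (by rwa [e])
          have hzq' : z < q := lt_of_le_of_ne hzq fun e => hqZ (by rwa [← e])
          refine ⟨X, mem_splitP.2 (Or.inl rfl), fun x hx => (hmem x).2 ⟨hZB' hx, ?_, ?_⟩⟩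
          · by_contra hc
            push Not at hc
            exact hZY (σ.nc Z hZ Y hY x p z q hc hpz' hzq' hx hz hp hq)
          · by_contra hc
            push Not at hc
            exact hZY (σ.nc Y hY Z hZ p z q x hpz' hzq' hc hp hq hz hx).symm
        · refine ⟨B' \ X, mem_splitP.2 (Or.inr (Or.inl rfl)), fun x hx =>
            Finset.mem_sdiff.2 ⟨hZB' hx, fun hxX => hex ⟨x, hx, ((hmem x).1 hxX).2⟩⟩⟩
    · exact ⟨B', mem_splitP.2 (Or.inr (Or.inr ⟨hBB, hB'⟩)), hZB'⟩

theorem split_anti (π : NCF m) {B X B' X' : Finset (Fin m)} (hB : B ∈ π.P) (hX : IsPart B X)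
    (hB' : B' ∈ π.P) (hX' : IsPart B' X') (h : Ref (splitP π.P B X) (splitP π.P B' X')) :
    B = B' ∧ X = X' := by
  have hBB : B = B' := by
    by_contra hne
    obtain ⟨Z, hZ, hs⟩ := h B' (mem_splitP.2 (Or.inr (Or.inr ⟨fun e => hne e.symm, hB'⟩)))
    obtain ⟨a, ha, hlt⟩ := hX'.2.2.1
    obtain ⟨x, hx⟩ := hX'.2.1
    rcases mem_splitP.1 hZ with rfl | rfl | ⟨h1, h2⟩
    · exact lt_irrefl _ (hlt a (hs ha))
    · exact (Finset.mem_sdiff.1 (hs (hX'.1 hx))).2 hx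
    · exact h1 (π.disj _ h2 _ hB' a (hs ha) ha)
  subst hBB
  refine ⟨rfl, ?_⟩
  obtain ⟨a, ha, hlt⟩ := hX.2.2.1
  obtain ⟨a', ha', hlt'⟩ := hX'.2.2.1
  -- the smaller of the two lower elements
  obtain ⟨e, he, heX, heX'⟩ : ∃ e ∈ B, e ∉ X ∧ e ∉ X' := by
    rcases le_total a a' with hh | hh
    · exact ⟨a, ha, fun h => lt_irrefl _ (hlt a h), fun h => not_lt_of_ge hh (hlt' a h)⟩
    · exact ⟨a', ha', fun h => not_lt_of_ge hh (hlt a' h), fun h => lt_irrefl _ (hlt' a' h)⟩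
  have h1 : B \ X ⊆ B \ X' := by
    obtain ⟨Z, hZ, hs⟩ := h (B \ X) (mem_splitP.2 (Or.inr (Or.inl rfl)))
    have heZ := hs (Finset.mem_sdiff.2 ⟨he, heX⟩)
    rcases mem_splitP.1 hZ with rfl | rfl | ⟨h1, h2⟩
    · exact absurd heZ heX'
    · exact hs
    · exact absurd (π.disj _ h2 _ hB e heZ he) h1
  have h2 : X' ⊆ X := by
    intro x hx
    by_contra hn
    exact (Finset.mem_sdiff.1 (h1 (Finset.mem_sdiff.2 ⟨hX'.1 hx, hn⟩))).2 hx
  obtain ⟨x', hx'⟩ := hX'.2.1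
  obtain ⟨Z, hZ, hs⟩ := h X (mem_splitP.2 (Or.inl rfl))
  have hxZ := hs (h2 hx')
  rcases mem_splitP.1 hZ with rfl | rfl | ⟨h3, h4⟩
  · exact Finset.Subset.antisymm hs h2
  · exact absurd hx' (Finset.mem_sdiff.1 hxZ).2
  · exact absurd (π.disj _ h4 _ hB x' hxZ (hX'.1 hx')) h3

theorem split_covBy (π : NCF m) (B X : Finset (Fin m)) (hB : B ∈ π.P) (hX : IsPart B X) :
    π.split B X hB hX ⋖ π := by
  refine ⟨split_lt π B X hB hX, fun τ h1 h2 => ?_⟩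
  obtain ⟨B', hB', X', hX', hr⟩ := exists_split h2
  have h3 : π.split B X hB hX ≤ π.split B' X' hB' hX' := h1.le.trans hr
  obtain ⟨rfl, rfl⟩ := split_anti π hB hX hB' hX' h3
  exact not_le_of_gt h1 hr

theorem covBy_split {σ π : NCF m} (h : σ ⋖ π) :
    ∃ B X, ∃ hB : B ∈ π.P, ∃ hX : IsPart B X, π.split B X hB hX = σ := by
  obtain ⟨B, hB, X, hX, hr⟩ := exists_split h.1
  refine ⟨B, X, hB, hX, ?_⟩
  have h1 : σ ≤ π.split B X hB hX := hr
  rcases h1.lt_or_eq with h2 | h2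
  · exact absurd (split_lt π B X hB hX) (h.2 h2)
  · exact h2.symm

/-- the closed formula -/
def f (P : Finset (Finset (Fin m))) : ℚ := ((m - P.card).factorial : ℚ) * ∏ B ∈ P, ncg B.card

theorem mem_parts {B X : Finset (Fin m)} : X ∈ parts B ↔ IsPart B X := by simp [parts]

open Classical in
theorem sum_covBy (π : NCF m) :
    ∑ σ ∈ Finset.univ.filter (fun σ => σ ⋖ π), f σ.P =
      ∑ B ∈ π.P, ∑ X ∈ parts B, f (splitP π.P B X) := by
  rw [Finset.sum_sigma']
  symm
  refine Finset.sum_bij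
    (fun p hp => π.split p.1 p.2 (Finset.mem_sigma.1 hp).1 (mem_parts.1 (Finset.mem_sigma.1 hp).2))
    ?_ ?_ ?_ ?_
  · intro p hp
    simp only [Finset.mem_filter, Finset.mem_univ, true_and]
    exact split_covBy _ _ _ _ _
  · rintro ⟨B, X⟩ hp ⟨B', X'⟩ hp' he
    have hp1 := Finset.mem_sigma.1 hp
    have hp2 := Finset.mem_sigma.1 hp'
    obtain ⟨h1, h2⟩ := split_anti π hp1.1 (mem_parts.1 hp1.2) hp2.1 (mem_parts.1 hp2.2) (le_def.1 he.le)
    simp only at h1 h2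
    subst h1 h2
    rfl
  · intro σ hσ
    simp only [Finset.mem_filter, Finset.mem_univ, true_and] at hσ
    obtain ⟨B, X, hB, hX, rfl⟩ := covBy_split hσ
    exact ⟨⟨B, X⟩, Finset.mem_sigma.2 ⟨hB, mem_parts.2 hX⟩, rfl⟩
  · intro p hp
    rfl

theorem f_split (π : NCF m) {B X : Finset (Fin m)} (hB : B ∈ π.P) (hX : IsPart B X) :
    f (splitP π.P B X) = ((m - π.P.card - 1).factorial : ℚ) *
      ((∏ Z ∈ π.P.erase B, ncg Z.card) * (ncg X.card * ncg (B.card - X.card))) := by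
  have h1 : X ∉ π.P.erase B := fun h => π.X_notMem hB hX (Finset.mem_of_mem_erase h)
  have h2 : B \ X ∉ π.P.erase B := fun h => π.BX_notMem hB hX (Finset.mem_of_mem_erase h)
  have h3 : X ∉ insert (B \ X) (π.P.erase B) := by
    rw [Finset.mem_insert, not_or]
    refine ⟨fun e => ?_, h1⟩
    obtain ⟨x, hx⟩ := hX.2.1
    have hx' := hx
    rw [e] at hx'
    exact (Finset.mem_sdiff.1 hx').2 hx
  have hc := Finset.card_erase_add_one hB
  unfold f splitP
  rw [Finset.prod_insert h3, Finset.prod_insert h2, Finset.card_insert_of_notMem h3,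
    Finset.card_insert_of_notMem h2, hc, Finset.card_sdiff_of_subset hX.1, Nat.sub_sub]
  ring

theorem sum_card (π : NCF m) : ∑ B ∈ π.P, B.card = m := by
  have h : π.P.biUnion id = Finset.univ := by
    ext a
    simp only [Finset.mem_biUnion, id, Finset.mem_univ, iff_true]
    exact π.cover a
  have h2 := Finset.card_biUnion (s := π.P) (t := id) (by
    intro B hB B' hB' hne
    rw [Function.onFun, Finset.disjoint_left]
    intro a ha ha'
    exact hne (π.disj B hB B' hB' a ha ha'))
  rw [h, Finset.card_univ, Fintype.card_fin] at h2
  exact h2.symm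

theorem sum_card_sub (π : NCF m) : ∑ B ∈ π.P, (B.card - 1) + π.P.card = m := by
  have h := sum_card π
  refine Eq.trans ?_ h
  rw [Finset.card_eq_sum_ones, ← Finset.sum_add_distrib]
  refine Finset.sum_congr rfl fun B hB => ?_
  have := (π.ne B hB).card_pos
  omega

theorem f_rec (π : NCF m) (h : π.P.card < m) :
    ∑ B ∈ π.P, ∑ X ∈ parts B, f (splitP π.P B X) = f π.P := by
  have h1 : ∀ B ∈ π.P, ∑ X ∈ parts B, f (splitP π.P B X) =
      ((m - π.P.card - 1).factorial : ℚ) * (∏ Z ∈ π.P, ncg Z.card) * ((B.card - 1 : ℕ) : ℚ) := by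
    intro B hB
    have e : ∀ X ∈ parts B, f (splitP π.P B X) =
        (fun i => ((m - π.P.card - 1).factorial : ℚ) *
      ((∏ Z ∈ π.P.erase B, ncg Z.card) * (ncg i * ncg (B.card - i)))) X.card :=
      fun X hX => f_split π hB (mem_parts.1 hX)
    rw [Finset.sum_congr rfl e, sum_parts B (π.ne B hB) (fun i => ((m - π.P.card - 1).factorial : ℚ) *
      ((∏ Z ∈ π.P.erase B, ncg Z.card) * (ncg i * ncg (B.card - i)))), ← Finset.mul_prod_erase _ _ hB]
    have := ncg_rec B.card (π.ne B hB).card_pos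
    rw [show ((m - π.P.card - 1).factorial : ℚ) * (ncg B.card * ∏ Z ∈ π.P.erase B, ncg Z.card) *
      ((B.card - 1 : ℕ) : ℚ) = ((m - π.P.card - 1).factorial : ℚ) * (∏ Z ∈ π.P.erase B, ncg Z.card) *
      (((B.card - 1 : ℕ) : ℚ) * ncg B.card) by ring, ← this, Finset.mul_sum]
    refine Finset.sum_congr rfl fun i _ => ?_
    ring
  rw [Finset.sum_congr rfl h1, ← Finset.mul_sum, ← Nat.cast_sum]
  have h2 : ∑ B ∈ π.P, (B.card - 1) = (m - π.P.card - 1) + 1 := by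
    have := sum_card_sub π
    omega
  have h3 : m - π.P.card = (m - π.P.card - 1) + 1 := by omega
  unfold f
  rw [h2]
  conv_rhs => rw [h3, Nat.factorial_succ]
  push_cast
  ring

theorem ncN_eq (π : NCF m) : (ncN π : ℚ) = f π.P := by
  classical
  induction π using WellFoundedLT.induction with
  | ind π ih =>
    by_cases hmin : ∃ σ, σ < π
    · rw [ncN_rec hmin, Nat.cast_sum]
      have hlt : π.P.card < m := by
        obtain ⟨σ, hσ⟩ := hmin
        obtain ⟨B, hB, X, hX, -⟩ := exists_split hσ
        obtain ⟨x, hx⟩ := hX.2.1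
        obtain ⟨a, ha, hl⟩ := hX.2.2.1
        have h1 : 1 < B.card := Finset.one_lt_card.2 ⟨a, ha, x, hX.1 hx, (hl x hx).ne⟩
        have h2 := Finset.single_le_sum (f := fun B : Finset (Fin m) => B.card - 1)
          (fun _ _ => Nat.zero_le _) hB
        have := sum_card_sub π
        omega
      rw [← f_rec π hlt, ← sum_covBy]
      refine Finset.sum_congr rfl fun σ hσ => ?_
      simp only [Finset.mem_filter, Finset.mem_univ, true_and] at hσ
      exact ih σ hσ.1
    · push Not at hmin
      rw [ncN_min hmin]
      have h1 : ∀ B ∈ π.P, B.card = 1 := by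
        intro B hB
        by_contra hne
        have hpos := (π.ne B hB).card_pos
        have h2 : 1 < B.card := by omega
        refine hmin _ (split_lt π B {B.max' (π.ne B hB)} hB ⟨?_, by simp, ?_, ?_⟩)
        · simpa using B.max'_mem _
        · refine ⟨B.min' (π.ne B hB), B.min'_mem _, ?_⟩
          intro x hx
          rw [Finset.mem_singleton] at hx
          subst hx
          exact B.min'_lt_max'_of_card h2
        · intro a ha c hc b hb hab hbc
          rw [Finset.mem_singleton] at *
          subst ha hc
          exact le_antisymm hbc hab
      have h2 : π.P.card = m := by
        have := sum_card π
        rw [Finset.sum_congr rfl h1] at this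
        simpa using this
      unfold f
      rw [h2, Finset.prod_congr rfl (fun B hB => by rw [h1 B hB])]
      simp [ncg]

def top (n : ℕ) : NCF (n + 1) where
  P := {Finset.univ}
  ne := by simp
  cover := by simp
  disj := by simp
  nc := by simp

theorem le_top' {n : ℕ} (π : NCF (n + 1)) : π ≤ top n :=
  fun B _ => ⟨Finset.univ, by simp [top], Finset.subset_univ _⟩

theorem ncN_top (n : ℕ) (hn : 0 < n) : ncN (top n) = (n + 1) ^ (n - 1) := by
  have h := ncN_eq (top n)
  have h2 : f (top n).P = ((n : ℚ) + 1) ^ (n - 1) := by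
    obtain ⟨k, rfl⟩ : ∃ k, n = k + 1 := ⟨n - 1, by omega⟩
    have h1 : ((k + 1).factorial : ℚ) ≠ 0 := by positivity
    simp only [f, top, ncg, Finset.card_singleton, Finset.prod_singleton, Finset.card_univ,
      Fintype.card_fin, Nat.add_sub_cancel]
    rw [Nat.factorial_succ (k + 1)]
    push_cast
    have h2 : (k : ℚ) + 1 + 1 ≠ 0 := by positivity
    field_simp
    ring
  rw [h2] at h
  exact_mod_cast h

theorem isMaxChain_iff {n : ℕ} (s : Set (NCF (n + 1))) :
    IsMaxChain (· ≤ ·) s ↔ NCQ (top n) s := by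
  have h : ∀ t : Set (NCF (n + 1)), t ⊆ Set.Iic (top n) := fun t x _ => le_top' x
  exact ⟨fun hs => ⟨h s, hs.1, fun t ht _ hst => hs.2 ht hst⟩,
    fun hs => ⟨hs.2.1, fun t ht hst => hs.2.2 t ht (h t) hst⟩⟩

theorem card_maxChains (n : ℕ) (hn : 0 < n) :
    Nat.card {s : Set (NCF (n + 1)) // IsMaxChain (· ≤ ·) s} = (n + 1) ^ (n - 1) := by
  classical
  rw [← ncN_top n hn, ncN, Nat.card_eq_fintype_card, Fintype.card_subtype]
  congr 1
  ext s
  simp [isMaxChain_iff]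

open Classical in
noncomputable def ofNC (π : NC m) : NCF m where
  P := Finset.univ.filter (fun B : Finset (Fin m) => (B : Set (Fin m)) ∈ π.1)
  ne := by
    intro B hB
    simp only [Finset.mem_filter, Finset.mem_univ, true_and] at hB
    by_contra hc
    rw [Finset.not_nonempty_iff_eq_empty] at hc
    subst hc
    exact π.2.1.1 (by simpa using hB)
  cover := by
    intro a
    obtain ⟨S, ⟨hS, haS⟩, -⟩ := π.2.1.2 a
    exact ⟨S.toFinset, by simpa using hS, by simpa using haS⟩
  disj := by
    intro B hB B' hB' a ha ha'
    simp only [Finset.mem_filter, Finset.mem_univ, true_and] at hB hB'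
    exact Finset.coe_injective ((π.2.1.2 a).unique ⟨hB, ha⟩ ⟨hB', ha'⟩)
  nc := by
    intro B hB B' hB' a b c d hab hbc hcd ha hc hb hd
    simp only [Finset.mem_filter, Finset.mem_univ, true_and] at hB hB'
    exact Finset.coe_injective (π.2.2 B hB B' hB' a b c d hab hbc hcd ha hc hb hd)

theorem mem_ofNC {π : NC m} {B : Finset (Fin m)} : B ∈ (ofNC π).P ↔ (B : Set (Fin m)) ∈ π.1 := by
  simp [ofNC]

theorem ofNC_le {π σ : NC m} : ofNC π ≤ ofNC σ ↔ Refines π σ := by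
  classical
  constructor
  · intro h S hS
    obtain ⟨B', hB', hs⟩ := h S.toFinset (mem_ofNC.2 (by simpa using hS))
    exact ⟨B', mem_ofNC.1 hB', by simpa using hs⟩
  · intro h B hB
    obtain ⟨S, hS, hs⟩ := h B (mem_ofNC.1 hB)
    refine ⟨S.toFinset, mem_ofNC.2 (by simpa using hS), fun x hx => ?_⟩
    simpa using hs hx

theorem ofNC_bij : Function.Bijective (ofNC (m := m)) := by
  classical
  constructor
  · intro π σ h
    apply Subtype.ext
    ext S
    have h1 : S.toFinset ∈ (ofNC π).P ↔ S.toFinset ∈ (ofNC σ).P := by rw [h]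
    simpa [mem_ofNC] using h1
  · intro τ
    refine ⟨⟨{S | S.toFinset ∈ τ.P}, ⟨?_, ?_⟩, ?_⟩, ?_⟩
    · intro h
      have := τ.ne _ h
      simp at this
    · intro a
      obtain ⟨B, hB, ha⟩ := τ.cover a
      refine ⟨(B : Set (Fin m)), ⟨by simpa using hB, ha⟩, ?_⟩
      rintro S ⟨hS, haS⟩
      have := τ.disj _ hS B hB a (by simpa using haS) ha
      rw [← this]
      simp
    · intro S hS S' hS' a b c d hab hbc hcd ha hc hb hd
      have := τ.nc _ hS _ hS' a b c d hab hbc hcd (by simpa using ha) (by simpa using hc)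
        (by simpa using hb) (by simpa using hd)
      simpa using this
    · apply NCF.ext
      ext B
      refine mem_ofNC.trans ?_
      change @Set.toFinset _ (B : Set (Fin m)) (_) ∈ τ.P ↔ B ∈ τ.P
      simp

noncomputable def iso : (Refines (m := m)) ≃r ((· ≤ ·) : NCF m → NCF m → Prop) where
  toEquiv := Equiv.ofBijective ofNC ofNC_bij
  map_rel_iff' := ofNC_le

end NCF

/-- For every positive integer `n`, the number of maximal chains of the
poset `NC_{n+1}` of noncrossing partitions of `{1, …, n+1}`, ordered by refinement,
equals `(n+1)^(n-1)`. -/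
theorem card_maxChains_noncrossingPartitions (n : ℕ) (hn : 0 < n) :
    Nat.card {s : Set (NC (n + 1)) // IsMaxChain Refines s} = (n + 1) ^ (n - 1) := by
  rw [← NCF.card_maxChains n hn]
  refine Nat.card_congr
    ⟨fun s => ⟨NCF.iso '' s.1, s.2.image NCF.iso⟩,
      fun s => ⟨NCF.iso.symm '' s.1, s.2.image NCF.iso.symm⟩, ?_, ?_⟩
  · rintro ⟨s, hs⟩
    apply Subtype.ext
    simp [Set.image_image]
  · rintro ⟨s, hs⟩
    apply Subtype.ext
    simp [Set.image_image]
end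

section
/- For every positive integer n, there exists a bijection between the set of parking functions of length n and the set of maximal chains of the poset NC_{n+1} of noncrossing partitions of {1, …, n+1} ordered by refinement. -/
/-- A sequence `α : Fin n → ℕ` (with entries in `{1, …, n}`) is a parking function of
length `n` if for every `i ∈ {1, …, n}`, the number of indices `j` with `α j ≤ i`
is at least `i`. -/
def IsParkingFunction (n : ℕ) (α : Fin n → ℕ) : Prop :=
  (∀ j, α j ∈ Finset.Icc 1 n) ∧
    ∀ i ∈ Finset.Icc 1 n, i ≤ (Finset.univ.filter fun j => α j ≤ i).card

def NCRel {m : ℕ} (r : Setoid (Fin m)) : Prop :=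
  ∀ a b c d : Fin m, a < b → b < c → c < d → r a c → r b d → r a b

/-- Noncrossing equivalence relations, ordered by refinement. -/
abbrev NCS (m : ℕ) : Type := {r : Setoid (Fin m) // NCRel r}

/-- The elements of the block of `i` in the interval `(i, b]`. -/
def InD {m : ℕ} (r : Setoid (Fin m)) (i b y : Fin m) : Prop := r i y ∧ i < y ∧ y ≤ b

/-- Split off `InD r i b` from its block. -/
def splitS {m : ℕ} (r : Setoid (Fin m)) (i b : Fin m) : Setoid (Fin m) where
  r x y := r x y ∧ (InD r i b x ↔ InD r i b y)
  iseqv := ⟨fun x => ⟨r.refl x, Iff.rfl⟩, fun h => ⟨r.symm h.1, h.2.symm⟩,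
    fun h k => ⟨r.trans h.1 k.1, h.2.trans k.2⟩⟩

theorem splitS_iff {m : ℕ} (r : Setoid (Fin m)) (i b x y : Fin m) :
    splitS r i b x y ↔ r x y ∧ (InD r i b x ↔ InD r i b y) := Iff.rfl

theorem splitS_nc {m : ℕ} (r : Setoid (Fin m)) (hr : NCRel r) (i b : Fin m) :
    NCRel (splitS r i b) := by
  intro x y z t hxy hyz hzt h1 h2
  rw [splitS_iff] at h1 h2 ⊢
  have h := hr x y z t hxy hyz hzt h1.1 h2.1
  have e1 := h1.2
  have e2 := h2.2
  have hyz' : r y z := r.trans (r.symm h) h1.1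
  have e3 : r i x ↔ r i y := ⟨fun k => r.trans k h, fun k => r.trans k (r.symm h)⟩
  have e4 : r i y ↔ r i z := ⟨fun k => r.trans k hyz', fun k => r.trans k (r.symm hyz')⟩
  have e5 : r i y ↔ r i t := ⟨fun k => r.trans k h2.1, fun k => r.trans k (r.symm h2.1)⟩
  refine ⟨h, ?_⟩
  unfold InD at *
  constructor
  · intro k
    have k2 := e1.1 k
    exact ⟨e3.1 k.1, k.2.1.trans hxy, hyz.le.trans k2.2.2⟩
  · intro k
    have k2 := e2.1 k
    exact e1.2 ⟨e4.1 k.1, k.2.1.trans hyz, hzt.le.trans k2.2.2⟩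

theorem splitS_lt {m : ℕ} (r : Setoid (Fin m)) (i b : Fin m) (hib : i < b) (h : r i b) :
    splitS r i b < r := by
  refine lt_of_le_not_ge (fun x y hxy => hxy.1) ?_
  intro hle
  have := (hle h).2
  have h2 : InD r i b b := ⟨h, hib, le_rfl⟩
  exact absurd (this.2 h2).2.1 (lt_irrefl _)

theorem splitS_inj {m : ℕ} (r : Setoid (Fin m)) (i b i' b' : Fin m) (hib : i < b) (h : r i b)
    (hib' : i' < b') (h' : r i' b') (hle : splitS r i b ≤ splitS r i' b') : i = i' ∧ b = b' := by
  have key : ∀ x y, r x y → (InD r i b x ↔ InD r i b y) → (InD r i' b' x ↔ InD r i' b' y) :=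
    fun x y h1 h2 => (hle (show splitS r i b x y from ⟨h1, h2⟩)).2
  have hi' : ¬ InD r i' b' i' := fun k => lt_irrefl _ k.2.1
  have hb' : InD r i' b' b' := ⟨h', hib', le_rfl⟩
  have hi : ¬ InD r i b i := fun k => lt_irrefl _ k.2.1
  have hb : InD r i b b := ⟨h, hib, le_rfl⟩
  have hii : r i i' := by
    by_contra hn
    have n1 : ¬ InD r i b i' := fun k => hn k.1
    have n2 : ¬ InD r i b b' := fun k => hn (r.trans k.1 (r.symm h'))
    have := key i' b' h' (by tauto)
    tauto
  have tr : ∀ y, r i y ↔ r i' y := fun y =>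
    ⟨fun k => r.trans (r.symm hii) k, fun k => r.trans hii k⟩
  have sb := r.symm h
  have si := r.symm hii
  have k1 := key i' i si
  have k2 := key i' b (r.trans si h)
  have k3 := key b' i (r.trans (r.symm h') si)
  have k4 := key b' b (r.trans (r.symm h') (r.trans si h))
  have e1 := (tr i').1 hii
  have e2 := (tr b').2 h'
  have e3 := (tr b).1 h
  have e4 := (tr i).1 (r.refl i)
  simp only [InD, hii, h, h', e1, e2, e3, e4, r.refl, true_and] at *
  constructor <;> omega

theorem exists_splitS {m : ℕ} (t r : Setoid (Fin m)) (ht : NCRel t) (hlt : t < r) :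
    ∃ i b, i < b ∧ r i b ∧ t ≤ splitS r i b := by
  classical
  have hle : ∀ {x y}, t x y → r x y := fun h => hlt.le h
  let S : Finset (Fin m) := Finset.univ.filter fun x => ∃ c, c < x ∧ r c x ∧ ¬ t c x
  have hS : S.Nonempty := by
    by_contra hn
    rw [Finset.not_nonempty_iff_eq_empty] at hn
    apply hlt.not_ge
    have hh : ∀ x c, c < x → r c x → t c x := by
      intro x c h1 h2
      by_contra h3
      have : x ∈ S := by simp only [S, Finset.mem_filter, Finset.mem_univ, true_and]; exact ⟨c, h1, h2, h3⟩
      simp [hn] at this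
    intro x y hxy
    rcases lt_trichotomy x y with h | h | h
    · exact hh _ _ h hxy
    · subst h; exact t.refl x
    · exact t.symm (hh _ _ h (r.symm hxy))
  obtain ⟨x, hxS, hxmin⟩ : ∃ x ∈ S, ∀ y ∈ S, x ≤ y := ⟨S.min' hS, S.min'_mem hS, fun y hy => S.min'_le y hy⟩
  simp only [S, Finset.mem_filter, Finset.mem_univ, true_and] at hxS hxmin
  obtain ⟨c, hcx, hrc, htc⟩ := hxS
  -- elements of the block below x are all t-equivalent
  have hbelow : ∀ y z, y < x → z < x → r y z → t y z := by
    have hh : ∀ y z, y < z → z < x → r y z → t y z := by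
      intro y z h1 h2 h3
      by_contra h4
      exact absurd (hxmin z ⟨y, h1, h3, h4⟩) (not_le.2 h2)
    intro y z h1 h2 h3
    rcases lt_trichotomy y z with h | h | h
    · exact hh _ _ h h2 h3
    · subst h; exact t.refl y
    · exact t.symm (hh _ _ h h1 (r.symm h3))
  let I : Finset (Fin m) := Finset.univ.filter fun y => r y x ∧ y < x
  have hI : I.Nonempty := ⟨c, by simp [I, hrc, hcx]⟩
  obtain ⟨i, hiI, himax⟩ : ∃ x ∈ I, ∀ y ∈ I, y ≤ x := ⟨I.max' hI, I.max'_mem hI, fun y hy => I.le_max' y hy⟩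
  simp only [I, Finset.mem_filter, Finset.mem_univ, true_and] at hiI himax
  obtain ⟨hrix, hix⟩ := hiI
  have htix : ¬ t i x := fun k => htc (t.trans (hbelow c i hcx hix (r.trans hrc (r.symm hrix))) k)
  let J : Finset (Fin m) := Finset.univ.filter fun b => r x b ∧ x ≤ b ∧
    ∀ y, r x y → x ≤ y → y ≤ b → ¬ t i y
  have hJ : J.Nonempty := by
    refine ⟨x, ?_⟩
    simp only [J, Finset.mem_filter, Finset.mem_univ, true_and]
    refine ⟨r.refl x, le_rfl, ?_⟩
    intro y _ h1 h2
    obtain rfl : y = x := le_antisymm h2 h1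
    exact htix
  obtain ⟨b, hbJ, hbmax⟩ : ∃ x ∈ J, ∀ y ∈ J, y ≤ x := ⟨J.max' hJ, J.max'_mem hJ, fun y hy => J.le_max' y hy⟩
  simp only [J, Finset.mem_filter, Finset.mem_univ, true_and] at hbJ hbmax
  obtain ⟨hrxb, hxb, hb⟩ := hbJ
  refine ⟨i, b, hix.trans_le hxb, r.trans hrix hrxb, ?_⟩
  have main : ∀ y z, t y z → InD r i b y → InD r i b z := by
    rintro y z hyz ⟨h1, h2, h3⟩
    have hxy : x ≤ y := by
      by_contra hn
      have := himax y ⟨r.trans (r.symm h1) hrix, not_le.1 hn⟩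
      omega
    have hrxy : r x y := r.trans (r.symm hrix) h1
    have nty := hb y hrxy hxy h3
    have hrz : r i z := r.trans h1 (hle hyz)
    refine ⟨hrz, ?_, ?_⟩
    · by_contra hn
      have : t i z := hbelow i z hix (by omega) hrz
      exact nty (t.trans this (t.symm hyz))
    · by_contra hn
      have hbz : b < z := not_le.1 hn
      have : ∃ y', r x y' ∧ x ≤ y' ∧ y' ≤ z ∧ t i y' := by
        by_contra hcon
        push Not at hcon
        have := hbmax z ⟨r.trans (r.symm hrix) hrz, by omega, hcon⟩
        omega
      obtain ⟨y', k1, k2, k3, k4⟩ := this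
      have hby' : b < y' := by
        by_contra hn'
        exact hb y' k1 k2 (not_lt.1 hn') k4
      have hne : y' ≠ z := by
        rintro rfl
        exact nty (t.trans k4 (t.symm hyz))
      exact nty (ht i y y' z h2 (by omega) (by omega) k4 hyz)
  intro y z hyz
  exact ⟨hle hyz, main y z hyz, main z y (t.symm hyz)⟩

/-- Pairs `(i,b)` indexing the elements covered by `r`. -/
abbrev QPair {m : ℕ} (r : Setoid (Fin m)) : Type := {q : Fin m × Fin m // q.1 < q.2 ∧ r q.1 q.2}

/-- The split, as a noncrossing relation. -/
def splitN {m : ℕ} (r : NCS m) (i b : Fin m) : NCS m := ⟨splitS r.1 i b, splitS_nc r.1 r.2 i b⟩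

theorem splitN_covBy {m : ℕ} (r : NCS m) (i b : Fin m) (h1 : i < b) (h2 : r.1 i b) :
    splitN r i b ⋖ r := by
  refine ⟨splitS_lt r.1 i b h1 h2, ?_⟩
  intro t ht1 ht2
  obtain ⟨i', b', h1', h2', h3'⟩ := exists_splitS t.1 r.1 t.2 ht2
  have hle : splitS r.1 i b ≤ t.1 := ht1.le
  obtain ⟨rfl, rfl⟩ := splitS_inj r.1 i b i' b' h1 h2 h1' h2' (hle.trans h3')
  exact (ht1.not_ge h3').elim

/-- Covers are indexed by pairs. -/
noncomputable def coverEquiv {m : ℕ} (r : NCS m) : QPair r.1 ≃ {t : NCS m // t ⋖ r} :=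
  Equiv.ofBijective (fun q => ⟨splitN r q.1.1 q.1.2, splitN_covBy r _ _ q.2.1 q.2.2⟩) (by
    constructor
    · rintro ⟨⟨i, b⟩, h1, h2⟩ ⟨⟨i', b'⟩, h1', h2'⟩ h
      have h' : splitS r.1 i b = splitS r.1 i' b' := congrArg (fun z => z.1.1) h
      obtain ⟨rfl, rfl⟩ := splitS_inj r.1 i b i' b' h1 h2 h1' h2' h'.le
      rfl
    · rintro ⟨t, ht⟩
      obtain ⟨i, b, h1, h2, h3⟩ := exists_splitS t.1 r.1 t.2 ht.lt
      refine ⟨⟨⟨i, b⟩, h1, h2⟩, ?_⟩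
      apply Subtype.ext
      have hle : t ≤ splitN r i b := h3
      rcases hle.lt_or_eq with h | h
      · exact absurd (splitN_covBy r i b h1 h2).lt (ht.2 h)
      · exact h.symm)

/-! ### Maximal chains -/

/-- Maximal chains of the lower set of `p`. -/
abbrev MC {P : Type*} [PartialOrder P] (p : P) : Type _ :=
  {s : Set P // p ∈ s ∧ s ⊆ Set.Iic p ∧ IsChain (· ≤ ·) s ∧
    ∀ t : Set P, t ⊆ Set.Iic p → IsChain (· ≤ ·) t → s ⊆ t → s = t}

theorem isChain_insert_top {P : Type*} [PartialOrder P] {p : P} {s : Set P} (hs : IsChain (· ≤ ·) s)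
    (h : s ⊆ Set.Iic p) : IsChain (· ≤ ·) (insert p s) :=
  hs.insert fun _ hb _ => Or.inr (h hb)

/-- Insert the top. -/
def mcStep {P : Type*} [PartialOrder P] (p : P) (x : Σ q : {q : P // q ⋖ p}, MC q.1) : MC p :=
  ⟨insert p x.2.1, by
    obtain ⟨⟨q, hq⟩, ⟨s, h1, h2, h3, h4⟩⟩ := x
    simp only at h1 h2 h3 h4 ⊢
    have h2' : s ⊆ Set.Iic p := fun y hy => (h2 hy).trans hq.le
    refine ⟨Set.mem_insert _ _, ?_, isChain_insert_top h3 h2', ?_⟩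
    · intro y hy
      rcases hy with rfl | hy
      · exact le_rfl
      · exact h2' hy
    · intro t ht1 ht2 ht3
      have hpt : p ∈ t := ht3 (Set.mem_insert _ _)
      have hst : s ⊆ t := fun y hy => ht3 (Set.mem_insert_of_mem _ hy)
      have : s = t \ {p} := by
        apply h4
        · rintro y ⟨hy, hyp⟩
          have hyp' : y < p := lt_of_le_of_ne (ht1 hy) hyp
          rcases ht2.total hy (hst h1) with h | h
          · exact h
          · rcases h.lt_or_eq with h' | h'
            · exact absurd hyp' (hq.2 h')
            · exact h'.symm.le
        · exact ht2.mono Set.sdiff_subset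
        · intro y hy
          refine ⟨hst hy, ?_⟩
          rintro rfl
          exact hq.lt.not_ge (h2 hy)
      rw [this, Set.insert_sdiff_singleton, Set.insert_eq_of_mem hpt]⟩

theorem mcStep_bijective {P : Type*} [PartialOrder P] [Finite P] (p : P) (hp : ∃ q, q < p) :
    Function.Bijective (mcStep p) := by
  constructor
  · rintro ⟨⟨q, hq⟩, ⟨s, h1, h2, h3, h4⟩⟩ ⟨⟨q', hq'⟩, ⟨s', h1', h2', h3', h4'⟩⟩ h
    have h : insert p s = insert p s' := congrArg Subtype.val h
    have n1 : p ∉ s := fun k => hq.lt.not_ge (h2 k)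
    have n2 : p ∉ s' := fun k => hq'.lt.not_ge (h2' k)
    have hs : s = s' := by
      ext y
      have := Set.ext_iff.1 h y
      simp only [Set.mem_insert_iff] at this
      by_cases hy : y = p
      · subst hy; tauto
      · tauto
    subst hs
    obtain rfl : q = q' := le_antisymm (h2' h1) (h2 h1')
    rfl
  · rintro ⟨s, h1, h2, h3, h4⟩
    have hne : (s \ {p}).Nonempty := by
      by_contra hn
      rw [Set.not_nonempty_iff_eq_empty, Set.sdiff_eq_empty] at hn
      obtain ⟨q, hq⟩ := hp
      have : s = {p, q} := by
        apply h4
        · rintro y (rfl | rfl)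
          · exact le_rfl
          · exact hq.le
        · exact isChain_insert_top (IsChain.singleton) (by rintro y rfl; exact hq.le)
        · exact hn.trans (by simp)
      have hqs : q ∈ s := by rw [this]; simp
      exact hq.ne (hn hqs)
    obtain ⟨q, hqm⟩ := (Set.toFinite (s \ {p})).exists_maximal hne
    have hqs := hqm.1
    have hmax : ∀ y ∈ s, y ≠ p → y ≤ q := by
      intro y hy hyp
      rcases h3.total hy hqs.1 with h | h
      · exact h
      · exact hqm.2 ⟨hy, hyp⟩ h
    have hqp : q < p := lt_of_le_of_ne (h2 hqs.1) hqs.2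
    have hins : insert p (s \ {p}) = s := by
      rw [Set.insert_sdiff_singleton, Set.insert_eq_of_mem h1]
    have hcov : q ⋖ p := by
      refine ⟨hqp, ?_⟩
      intro y hy1 hy2
      have : s = insert y s := by
        apply h4
        · rintro z (rfl | hz)
          · exact hy2.le
          · exact h2 hz
        · refine h3.insert ?_
          intro z hz _
          by_cases hzp : z = p
          · subst hzp; exact Or.inl hy2.le
          · exact Or.inr ((hmax z hz hzp).trans hy1.le)
        · exact Set.subset_insert _ _
      have hys : y ∈ s := by rw [this]; exact Set.mem_insert _ _
      exact hy1.not_ge (hmax y hys hy2.ne)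
    refine ⟨⟨⟨q, hcov⟩, ⟨s \ {p}, hqs, fun y hy => hmax y hy.1 hy.2, h3.mono Set.sdiff_subset, ?_⟩⟩,
      Subtype.ext hins⟩
    intro t ht1 ht2 ht3
    have ht1' : t ⊆ Set.Iic p := fun y hy => (ht1 hy).trans hqp.le
    have : s = insert p t := by
      apply h4
      · rintro z (rfl | hz)
        · exact le_rfl
        · exact ht1' hz
      · exact isChain_insert_top ht2 ht1'
      · rw [← hins]; exact Set.insert_subset_insert ht3
    have hpt : p ∉ t := fun k => hqp.not_ge (ht1 k)
    rw [this]
    simp [hpt]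

theorem mc_minimal {P : Type*} [PartialOrder P] (p : P) (hp : ¬ ∃ q, q < p) :
    Nonempty (Unique (MC p)) := by
  have hI : Set.Iic p = {p} := by
    ext y
    simp only [Set.mem_Iic, Set.mem_singleton_iff]
    constructor
    · intro h
      rcases h.lt_or_eq with h | h
      · exact absurd ⟨y, h⟩ hp
      · exact h
    · rintro rfl; exact le_rfl
  refine ⟨⟨⟨⟨{p}, rfl, hI.ge, IsChain.singleton, fun t h1 _ h3 => h3.antisymm (h1.trans hI.le)⟩⟩, ?_⟩⟩
  rintro ⟨s, h1, h2, h3, h4⟩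
  apply Subtype.ext
  exact (h2.trans hI.le).antisymm (Set.singleton_subset_iff.2 h1)

theorem mc_top_iff {P : Type*} [PartialOrder P] [OrderTop P] (s : Set P) :
    (⊤ ∈ s ∧ s ⊆ Set.Iic ⊤ ∧ IsChain (· ≤ ·) s ∧
    ∀ t : Set P, t ⊆ Set.Iic ⊤ → IsChain (· ≤ ·) t → s ⊆ t → s = t) ↔
    IsMaxChain (· ≤ ·) s := by
  constructor
  · rintro ⟨h1, h2, h3, h4⟩
    exact ⟨h3, fun t ht hst => h4 t (by simp) ht hst⟩
  · intro h
    exact ⟨h.top_mem, by simp, h.1, fun t _ ht hst => h.2 ht hst⟩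

/-! ### Counting in lists -/

open Classical in
/-- Number of entries of `L` satisfying `p`. -/
noncomputable def cnt {m : ℕ} (L : List (Fin m)) (p : Fin m → Prop) : ℕ :=
  L.countP (fun y => decide (p y))

theorem cnt_congr {m : ℕ} (L : List (Fin m)) {p q : Fin m → Prop} (h : ∀ y, p y ↔ q y) :
    cnt L p = cnt L q := by
  have : p = q := funext fun y => propext (h y)
  rw [this]

theorem cnt_mono {m : ℕ} (L : List (Fin m)) {p q : Fin m → Prop} (h : ∀ y, p y → q y) :
    cnt L p ≤ cnt L q := by
  unfold cnt
  apply List.countP_mono_left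
  intro x _ hx
  simpa using h x (by simpa using hx)

theorem cnt_cons {m : ℕ} (L : List (Fin m)) (i : Fin m) (p : Fin m → Prop) [Decidable (p i)] :
    cnt (i :: L) p = cnt L p + if p i then 1 else 0 := by
  unfold cnt
  rw [List.countP_cons]
  simp

theorem cnt_add {m : ℕ} (L : List (Fin m)) {p q s : Fin m → Prop} (h : ∀ y, p y ↔ q y ∨ s y)
    (h' : ∀ y, q y → ¬ s y) : cnt L p = cnt L q + cnt L s := by
  classical
  induction L with
  | nil => simp [cnt]
  | cons a L ih =>
    rw [cnt_cons, cnt_cons, cnt_cons, ih]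
    have h1 := h a
    have h2 := h' a
    by_cases hq : q a <;> by_cases hs : s a <;> simp [h1, hq, hs] <;> first | omega | tauto

theorem cnt_E_card {m : ℕ} (p : Fin m → Prop) [DecidablePred p] :
    cnt (List.finRange m) p = (Finset.univ.filter p).card := by
  rw [Finset.card_def, Finset.filter_val]
  have : (Finset.univ : Finset (Fin m)).val = (List.finRange m : Multiset (Fin m)) := rfl
  rw [this, Multiset.filter_coe, Multiset.coe_card, cnt, List.countP_eq_length_filter]
  congr!

theorem cnt_E_single {m : ℕ} (z : Fin m) : cnt (List.finRange m) (fun y => y = z) = 1 := by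
  classical
  rw [cnt_E_card]
  simp only [Finset.filter_eq', Finset.mem_univ, if_true, Finset.card_singleton]

/-! ### Parking words of a partition -/

/-- Words parking every block of `r`. -/
def ParkW {m : ℕ} (r : Setoid (Fin m)) (w : List (Fin m)) : Prop :=
  (∀ x, cnt w (fun y => r x y) + 1 = cnt (List.finRange m) (fun y => r x y)) ∧
  (∀ x z, r x z → x < z → cnt (List.finRange m) (fun y => r x y ∧ y ≤ x) ≤
    cnt w (fun y => r x y ∧ y ≤ x))

/-- The parking condition for the blocks other than that of `i`. -/
def ParkO {m : ℕ} (r : Setoid (Fin m)) (i : Fin m) (w : List (Fin m)) : Prop :=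
  (∀ x, ¬ r i x → cnt w (fun y => r x y) + 1 = cnt (List.finRange m) (fun y => r x y)) ∧
  (∀ x z, ¬ r i x → r x z → x < z → cnt (List.finRange m) (fun y => r x y ∧ y ≤ x) ≤
    cnt w (fun y => r x y ∧ y ≤ x))

/-- Entries in the block of `i` that are at most `x`. -/
noncomputable def cA {m : ℕ} (r : Setoid (Fin m)) (i : Fin m) (L : List (Fin m)) (x : Fin m) : ℕ :=
  cnt L (fun y => r i y ∧ y ≤ x)

/-- Entries in the block of `i` in the interval `(i, x]`. -/
noncomputable def cT {m : ℕ} (r : Setoid (Fin m)) (i : Fin m) (L : List (Fin m)) (x : Fin m) : ℕ :=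
  cnt L (fun y => r i y ∧ i < y ∧ y ≤ x)

/-- Entries in the block of `i`. -/
noncomputable def cB {m : ℕ} (r : Setoid (Fin m)) (i : Fin m) (L : List (Fin m)) : ℕ :=
  cnt L (fun y => r i y)

theorem cA_eq {m : ℕ} (r : Setoid (Fin m)) (i : Fin m) (L : List (Fin m)) (x : Fin m) (h : i ≤ x) :
    cA r i L x = cA r i L i + cT r i L x := by
  apply cnt_add
  · intro y
    have : y ≤ x ↔ y ≤ i ∨ (i < y ∧ y ≤ x) := by omega
    tauto
  · intro y h1 h2
    omega

theorem cT_mono {m : ℕ} (r : Setoid (Fin m)) (i : Fin m) (L : List (Fin m)) (x z : Fin m) (h : x ≤ z) :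
    cT r i L x ≤ cT r i L z :=
  cnt_mono L fun _ k => ⟨k.1, k.2.1, k.2.2.trans h⟩

theorem cA_le_cB {m : ℕ} (r : Setoid (Fin m)) (i : Fin m) (L : List (Fin m)) (x : Fin m) :
    cA r i L x ≤ cB r i L := cnt_mono L fun _ k => k.1

theorem cA_mono {m : ℕ} (r : Setoid (Fin m)) (i : Fin m) (L : List (Fin m)) (x z : Fin m) (h : x ≤ z) :
    cA r i L x ≤ cA r i L z := cnt_mono L fun _ k => ⟨k.1, k.2.trans h⟩

theorem cA_max {m : ℕ} (r : Setoid (Fin m)) (i : Fin m) (L : List (Fin m)) (x : Fin m)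
    (h : ∀ z, r i z → z ≤ x) : cA r i L x = cB r i L :=
  cnt_congr L fun y => ⟨fun k => k.1, fun k => ⟨k, h y k⟩⟩

theorem relCls_congr {m : ℕ} (r : Setoid (Fin m)) {i x : Fin m} (h : r i x) (y : Fin m) :
    r x y ↔ r i y := ⟨fun k => r.trans h k, fun k => r.trans (r.symm h) k⟩

theorem parkW_cons {m : ℕ} (r : Setoid (Fin m)) (i : Fin m) (w : List (Fin m)) :
    ParkW r (i :: w) ↔ ParkO r i w ∧ cB r i w + 2 = cB r i (List.finRange m) ∧
      (∀ x z, r i x → r i z → x < z → x < i → cA r i (List.finRange m) x ≤ cA r i w x) ∧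
      (∀ x z, r i x → r i z → x < z → i ≤ x → cA r i (List.finRange m) x ≤ cA r i w x + 1) := by
  classical
  have e1 : ∀ L x, r i x → cnt L (fun y => r x y) = cB r i L := fun L x h =>
    cnt_congr L fun y => relCls_congr r h y
  have e2 : ∀ L x, r i x → cnt L (fun y => r x y ∧ y ≤ x) = cA r i L x := fun L x h =>
    cnt_congr L fun y => and_congr_left fun _ => relCls_congr r h y
  have s : ∀ x, ¬ r i x → ¬ r x i := fun x h k => h (r.symm k)
  have c1 : ∀ x, ¬ r i x → cnt (i :: w) (fun y => r x y) = cnt w (fun y => r x y) := by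
    intro x h; rw [cnt_cons]; simp [s x h]
  have c2 : ∀ x, ¬ r i x → cnt (i :: w) (fun y => r x y ∧ y ≤ x) = cnt w (fun y => r x y ∧ y ≤ x) := by
    intro x h; rw [cnt_cons]; simp [s x h]
  have c3 : cB r i (i :: w) = cB r i w + 1 := by
    unfold cB; rw [cnt_cons, if_pos (r.refl i)]
  have c4 : ∀ x, x < i → cA r i (i :: w) x = cA r i w x := by
    intro x h; unfold cA; rw [cnt_cons, if_neg (fun k => by omega)]; simp
  have c5 : ∀ x, i ≤ x → cA r i (i :: w) x = cA r i w x + 1 := by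
    intro x h; unfold cA; rw [cnt_cons, if_pos ⟨r.refl i, h⟩]
  constructor
  · rintro ⟨h1, h2⟩
    refine ⟨⟨?_, ?_⟩, ?_, ?_, ?_⟩
    · intro x hx; rw [← c1 x hx]; exact h1 x
    · intro x z hx hxz hlt; rw [← c2 x hx]; exact h2 x z hxz hlt
    · have := h1 i; rw [e1 _ _ (r.refl i), e1 _ _ (r.refl i), c3] at this; omega
    · intro x z hx hz hlt hxi
      have := h2 x z ((relCls_congr r hx z).2 hz) hlt
      rwa [e2 _ _ hx, e2 _ _ hx, c4 x hxi] at this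
    · intro x z hx hz hlt hxi
      have := h2 x z ((relCls_congr r hx z).2 hz) hlt
      rwa [e2 _ _ hx, e2 _ _ hx, c5 x hxi] at this
  · rintro ⟨⟨h1, h2⟩, h3, h4, h5⟩
    constructor
    · intro x
      by_cases hx : r i x
      · rw [e1 _ _ hx, e1 _ _ hx, c3]; omega
      · rw [c1 x hx]; exact h1 x hx
    · intro x z hxz hlt
      by_cases hx : r i x
      · rw [e2 _ _ hx, e2 _ _ hx]
        have hz := (relCls_congr r hx z).1 hxz
        rcases lt_or_ge x i with h | h
        · rw [c4 x h]; exact h4 x z hx hz hlt h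
        · rw [c5 x h]; exact h5 x z hx hz hlt h
      · rw [c2 x hx]; exact h2 x z hx hxz hlt

theorem parkW_split {m : ℕ} (r : Setoid (Fin m)) (i b : Fin m) (hib : i < b) (hr : r i b)
    (w : List (Fin m)) :
    ParkW (splitS r i b) w ↔ ParkO r i w ∧ cB r i w + 2 = cB r i (List.finRange m) ∧
      cT r i w b + 1 = cT r i (List.finRange m) b ∧
      (∀ x, r i x → i < x → x < b → cT r i (List.finRange m) x ≤ cT r i w x) ∧
      (∀ x z, r i x → r i z → x < z → x ≤ i → (z ≤ i ∨ b < z) →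
        cA r i (List.finRange m) x ≤ cA r i w x) ∧
      (∀ x z, r i x → r i z → x < z → b < x →
        cA r i (List.finRange m) x ≤ cA r i w x + 1) := by
  have o : ∀ x, ¬ r i x → ∀ y, splitS r i b x y ↔ r x y := by
    intro x hx y
    rw [splitS_iff]
    refine ⟨fun k => k.1, fun k => ⟨k, ?_⟩⟩
    have hy : ¬ r i y := fun h => hx (r.trans h (r.symm k))
    unfold InD
    tauto
  have d : ∀ x, InD r i b x → ∀ y, splitS r i b x y ↔ InD r i b y := by
    intro x hx y
    rw [splitS_iff]
    refine ⟨fun k => k.2.1 hx, fun k => ⟨?_, fun _ => k, fun _ => hx⟩⟩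
    exact (relCls_congr r hx.1 y).2 k.1
  have n : ∀ x, r i x → ¬ InD r i b x → ∀ y, splitS r i b x y ↔ (r i y ∧ ¬ InD r i b y) := by
    intro x hx hx' y
    rw [splitS_iff, relCls_congr r hx y]
    tauto
  have o1 : ∀ L x, ¬ r i x → cnt L (fun y => splitS r i b x y) = cnt L (fun y => r x y) :=
    fun L x hx => cnt_congr L (o x hx)
  have o2 : ∀ L x, ¬ r i x → cnt L (fun y => splitS r i b x y ∧ y ≤ x) =
      cnt L (fun y => r x y ∧ y ≤ x) :=
    fun L x hx => cnt_congr L fun y => and_congr_left fun _ => o x hx y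
  have d1 : ∀ L x, InD r i b x → cnt L (fun y => splitS r i b x y) = cT r i L b :=
    fun L x hx => cnt_congr L (d x hx)
  have d2 : ∀ L x, InD r i b x → cnt L (fun y => splitS r i b x y ∧ y ≤ x) = cT r i L x := by
    intro L x hx
    apply cnt_congr
    intro y
    rw [d x hx]
    unfold InD at *
    have : y ≤ x → y ≤ b := fun h => h.trans hx.2.2
    tauto
  have n1 : ∀ L x, r i x → ¬ InD r i b x → cB r i L = cnt L (fun y => splitS r i b x y) + cT r i L b := by
    intro L x hx hx'
    apply cnt_add
    · intro y
      rw [n x hx hx' y]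
      unfold InD
      tauto
    · intro y h1 h2
      rw [n x hx hx' y] at h1
      exact h1.2 h2
  have n2 : ∀ L x, r i x → x ≤ i → cnt L (fun y => splitS r i b x y ∧ y ≤ x) = cA r i L x := by
    intro L x hx hxi
    apply cnt_congr
    intro y
    rw [n x hx (fun k => by have := k.2.1; omega) y]
    unfold InD
    have : y ≤ x → ¬ i < y := by omega
    tauto
  have n3 : ∀ L x, r i x → b < x → cA r i L x = cnt L (fun y => splitS r i b x y ∧ y ≤ x) + cT r i L b := by
    intro L x hx hbx
    have hx' : ¬ InD r i b x := fun k => by have := k.2.2; omega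
    apply cnt_add
    · intro y
      rw [n x hx hx' y]
      unfold InD
      have : y ≤ b → y ≤ x := by omega
      tauto
    · intro y h1 h2
      rw [n x hx hx' y] at h1
      exact h1.1.2 h2
  have hbD : InD r i b b := ⟨hr, hib, le_rfl⟩
  have hiD : ¬ InD r i b i := fun k => lt_irrefl _ k.2.1
  constructor
  · rintro ⟨h1, h2⟩
    have hT : cT r i w b + 1 = cT r i (List.finRange m) b := by
      rw [← d1 _ b hbD, ← d1 _ b hbD]; exact h1 b
    refine ⟨⟨?_, ?_⟩, ?_, hT, ?_, ?_, ?_⟩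
    · intro x hx; rw [← o1 _ x hx, ← o1 _ x hx]; exact h1 x
    · intro x z hx hxz hlt
      rw [← o2 _ x hx, ← o2 _ x hx]; exact h2 x z ((o x hx z).2 hxz) hlt
    · have a1 := n1 w i (r.refl i) hiD
      have a2 := n1 (List.finRange m) i (r.refl i) hiD
      have a3 := h1 i
      omega
    · intro x hx hix hxb
      have hxD : InD r i b x := ⟨hx, hix, hxb.le⟩
      rw [← d2 _ x hxD, ← d2 _ x hxD]
      exact h2 x b ((d x hxD b).2 hbD) hxb
    · intro x z hx hz hlt hxi hzz
      rw [← n2 _ x hx hxi, ← n2 _ x hx hxi]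
      refine h2 x z ?_ hlt
      rw [n x hx (fun k => by have := k.2.1; omega)]
      exact ⟨hz, fun k => by have := k.2.1; have := k.2.2; omega⟩
    · intro x z hx hz hlt hbx
      rw [n3 _ x hx hbx, n3 _ x hx hbx]
      have := h2 x z (by
        rw [n x hx (fun k => by have := k.2.2; omega)]
        exact ⟨hz, fun k => by have := k.2.2; omega⟩) hlt
      omega
  · rintro ⟨⟨h1, h2⟩, hB, hT, h3, h4, h5⟩
    constructor
    · intro x
      by_cases hx : r i x
      · by_cases hxD : InD r i b x
        · rw [d1 _ x hxD, d1 _ x hxD]; exact hT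
        · have a1 := n1 w x hx hxD
          have a2 := n1 (List.finRange m) x hx hxD
          omega
      · rw [o1 _ x hx, o1 _ x hx]; exact h1 x hx
    · intro x z hxz hlt
      by_cases hx : r i x
      · by_cases hxD : InD r i b x
        · rw [d2 _ x hxD, d2 _ x hxD]
          have hzD := (d x hxD z).1 hxz
          exact h3 x hx hxD.2.1 (hlt.trans_le hzD.2.2)
        · have hz := (n x hx hxD z).1 hxz
          have hz2 : z ≤ i ∨ b < z := by
            by_contra hc
            exact hz.2 ⟨hz.1, by omega, by omega⟩
          have hx2 : x ≤ i ∨ b < x := by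
            by_contra hc
            exact hxD ⟨hx, by omega, by omega⟩
          rcases hx2 with hxi | hbx
          · rw [n2 _ x hx hxi, n2 _ x hx hxi]
            exact h4 x z hx hz.1 hlt hxi hz2
          · have a0 := h5 x z hx hz.1 hlt hbx
            rw [n3 _ x hx hbx, n3 _ x hx hbx] at a0
            omega
      · rw [o2 _ x hx, o2 _ x hx]
        exact h2 x z hx ((o x hx z).1 hxz) hlt

/-- Predecessor in the block: the count of `(i, b]` is one more than that at the predecessor. -/
theorem cT_pred {m : ℕ} (r : Setoid (Fin m)) (i b : Fin m) (hib : i < b) (hr : r i b) :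
    cT r i (List.finRange m) b = 1 ∨ ∃ z, r i z ∧ i < z ∧ z < b ∧
      cT r i (List.finRange m) b = cT r i (List.finRange m) z + 1 := by
  classical
  let I : Finset (Fin m) := Finset.univ.filter fun y => r i y ∧ i < y ∧ y < b
  rcases I.eq_empty_or_nonempty with h | h
  · left
    rw [← cnt_E_single b]
    apply cnt_congr
    intro y
    constructor
    · rintro ⟨h1, h2, h3⟩
      by_contra hne
      have : y ∈ I := by
        simp only [I, Finset.mem_filter, Finset.mem_univ, true_and]
        exact ⟨h1, h2, lt_of_le_of_ne h3 hne⟩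
      simp [h] at this
    · rintro rfl; exact ⟨hr, hib, le_rfl⟩
  · right
    obtain ⟨z, hz, hmax⟩ : ∃ x ∈ I, ∀ y ∈ I, y ≤ x := ⟨I.max' h, I.max'_mem h, fun y hy => I.le_max' y hy⟩
    simp only [I, Finset.mem_filter, Finset.mem_univ, true_and] at hz hmax
    refine ⟨z, hz.1, hz.2.1, hz.2.2, ?_⟩
    rw [← cnt_E_single b]
    apply cnt_add
    · intro y
      constructor
      · rintro ⟨h1, h2, h3⟩
        rcases h3.lt_or_eq with h | h
        · exact Or.inl ⟨h1, h2, hmax y ⟨h1, h2, h⟩⟩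
        · exact Or.inr h
      · rintro (⟨h1, h2, h3⟩ | rfl)
        · exact ⟨h1, h2, h3.trans hz.2.2.le⟩
        · exact ⟨hr, hib, le_rfl⟩
    · rintro y ⟨_, _, h3⟩ rfl
      have := hz.2.2
      omega

theorem park_up {m : ℕ} (r : Setoid (Fin m)) (i b : Fin m) (hib : i < b) (hr : r i b)
    (w : List (Fin m)) (h : ParkW (splitS r i b) w) : ParkW r (i :: w) := by
  rw [parkW_split r i b hib hr] at h
  rw [parkW_cons]
  obtain ⟨hO, hB, hT, h3, h4, h5⟩ := h
  have hI : cA r i (List.finRange m) i ≤ cA r i w i + 1 := by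
    by_cases hz : ∃ z, r i z ∧ b < z
    · obtain ⟨z, hz, hbz⟩ := hz
      have := h4 i z (r.refl i) hz (by omega) le_rfl (Or.inr hbz)
      omega
    · push Not at hz
      have a1 := cA_eq r i w b hib.le
      have a2 := cA_eq r i (List.finRange m) b hib.le
      rw [cA_max r i _ b hz] at a1 a2
      omega
  refine ⟨hO, hB, ?_, ?_⟩
  · intro x z hx hz hlt hxi
    exact h4 x i hx (r.refl i) hxi hxi.le (Or.inl le_rfl)
  · intro x z hx hz hlt hix
    have a1 := cA_eq r i w x hix
    have a2 := cA_eq r i (List.finRange m) x hix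
    rcases hix.lt_or_eq with hix' | rfl
    · rcases lt_trichotomy x b with hxb | rfl | hxb
      · have := h3 x hx hix' hxb
        omega
      · have := h4 i z (r.refl i) hz (by omega) le_rfl (Or.inr hlt)
        omega
      · exact h5 x z hx hz hlt hxb
    · exact hI

theorem park_unique {m : ℕ} (r : Setoid (Fin m)) (i b b' : Fin m) (hib : i < b) (hr : r i b)
    (hib' : i < b') (hr' : r i b') (w : List (Fin m)) (h : ParkW (splitS r i b) w)
    (h' : ParkW (splitS r i b') w) : b = b' := by
  rw [parkW_split r i b hib hr] at h
  rw [parkW_split r i b' hib' hr'] at h'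
  obtain ⟨_, _, hT, h3, _, _⟩ := h
  obtain ⟨_, _, hT', h3', _, _⟩ := h'
  rcases lt_trichotomy b b' with h | h | h
  · have := h3' b hr hib h; omega
  · exact h
  · have := h3 b' hr' hib' h; omega

theorem park_down {m : ℕ} (r : Setoid (Fin m)) (i : Fin m) (w : List (Fin m))
    (h : ParkW r (i :: w)) : ∃ b, i < b ∧ r i b ∧ ParkW (splitS r i b) w := by
  classical
  rw [parkW_cons] at h
  obtain ⟨hO, hB, h1, h2⟩ := h
  -- the maximum of the block
  let M : Finset (Fin m) := Finset.univ.filter fun y => r i y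
  have hM : M.Nonempty := ⟨i, by simp only [M, Finset.mem_filter, Finset.mem_univ, true_and]; exact r.refl i⟩
  obtain ⟨t, ht, htmax⟩ : ∃ x ∈ M, ∀ y ∈ M, y ≤ x := ⟨M.max' hM, M.max'_mem hM, fun y hy => M.le_max' y hy⟩
  simp only [M, Finset.mem_filter, Finset.mem_univ, true_and] at ht htmax
  have hit : i < t := by
    refine lt_of_le_of_ne (htmax i (r.refl i)) ?_
    rintro rfl
    -- i is the maximum; look at its predecessor
    let I : Finset (Fin m) := Finset.univ.filter fun y => r i y ∧ y < i
    have split : cB r i (List.finRange m) = cnt (List.finRange m) (fun y => r i y ∧ y < i) + 1 := by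
      rw [← cnt_E_single i]
      apply cnt_add
      · intro y
        constructor
        · intro hy
          rcases (htmax y hy).lt_or_eq with h | h
          · exact Or.inl ⟨hy, h⟩
          · exact Or.inr h
        · rintro (h | rfl)
          · exact h.1
          · exact r.refl _
      · rintro y h rfl
        exact lt_irrefl _ h.2
    have hI : I.Nonempty := by
      rw [← Finset.card_pos]
      have : cnt (List.finRange m) (fun y => r i y ∧ y < i) = I.card := cnt_E_card _
      omega
    obtain ⟨p, hp, hpmax⟩ : ∃ x ∈ I, ∀ y ∈ I, y ≤ x := ⟨I.max' hI, I.max'_mem hI, fun y hy => I.le_max' y hy⟩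
    simp only [I, Finset.mem_filter, Finset.mem_univ, true_and] at hp hpmax
    have a1 := h1 p i hp.1 (r.refl i) hp.2 hp.2
    have a2 := cA_le_cB r i w p
    have a3 : cnt (List.finRange m) (fun y => r i y ∧ y < i) = cA r i (List.finRange m) p :=
      cnt_congr _ fun y => ⟨fun k => ⟨k.1, hpmax y k⟩, fun k => ⟨k.1, k.2.trans_lt hp.2⟩⟩
    omega
  have hAi := h2 i t (r.refl i) ht hit le_rfl
  let S : Finset (Fin m) := Finset.univ.filter fun y => r i y ∧ i < y ∧
    cT r i w y < cT r i (List.finRange m) y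
  have hS : S.Nonempty := by
    refine ⟨t, ?_⟩
    simp only [S, Finset.mem_filter, Finset.mem_univ, true_and]
    refine ⟨ht, hit, ?_⟩
    have a1 := cA_eq r i w t hit.le
    have a2 := cA_eq r i (List.finRange m) t hit.le
    rw [cA_max r i _ t htmax] at a1 a2
    omega
  obtain ⟨b, hb, hbmin⟩ : ∃ x ∈ S, ∀ y ∈ S, x ≤ y := ⟨S.min' hS, S.min'_mem hS, fun y hy => S.min'_le y hy⟩
  simp only [S, Finset.mem_filter, Finset.mem_univ, true_and] at hb hbmin
  obtain ⟨hr, hib, hTb⟩ := hb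
  have hmin : ∀ x, r i x → i < x → x < b → cT r i (List.finRange m) x ≤ cT r i w x := by
    intro x hx hix hxb
    by_contra hc
    have := hbmin x ⟨hx, hix, not_le.1 hc⟩
    omega
  have hT : cT r i w b + 1 = cT r i (List.finRange m) b := by
    rcases cT_pred r i b hib hr with h | ⟨z, hz1, hz2, hz3, hz4⟩
    · omega
    · have := hmin z hz1 hz2 hz3
      have := cT_mono r i w z b hz3.le
      omega
  refine ⟨b, hib, hr, ?_⟩
  rw [parkW_split r i b hib hr]
  refine ⟨hO, hB, hT, hmin, ?_, ?_⟩
  · intro x z hx hz hlt hxi hzz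
    rcases hxi.lt_or_eq with h | rfl
    · exact h1 x z hx hz hlt h
    · have hbz : b < z := by omega
      have a0 := h2 b z hr hz hbz hib.le
      have a1 := cA_eq r x w b hib.le
      have a2 := cA_eq r x (List.finRange m) b hib.le
      omega
  · intro x z hx hz hlt hbx
    exact h2 x z hx hz hlt (by omega)

/-- Parking words of `r`. -/
abbrev WS {m : ℕ} (r : NCS m) : Type := {w : List (Fin m) // ParkW r.1 w}

/-- Adding a letter. -/
def wStep {m : ℕ} (r : NCS m) (x : Σ q : QPair r.1, WS (splitN r q.1.1 q.1.2)) : WS r :=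
  ⟨x.1.1.1 :: x.2.1, park_up r.1 _ _ x.1.2.1 x.1.2.2 _ x.2.2⟩

theorem parkW_nil {m : ℕ} (r : Setoid (Fin m)) (h : ParkW r []) (x y : Fin m) (hxy : r x y) :
    x = y := by
  classical
  have h1 := h.1 x
  rw [cnt_E_card] at h1
  simp only [cnt, List.countP_nil, zero_add] at h1
  obtain ⟨z, hz⟩ := Finset.card_eq_one.1 h1.symm
  have a1 : x ∈ Finset.univ.filter fun y => r x y := by simp
  have a2 : y ∈ Finset.univ.filter fun y => r x y := by simpa using hxy
  rw [hz] at a1 a2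
  simp only [Finset.mem_singleton] at a1 a2
  rw [a1, a2]

theorem wStep_bijective {m : ℕ} (r : NCS m) (hr : ∃ q, q < r) : Function.Bijective (wStep r) := by
  constructor
  · rintro ⟨⟨⟨i, b⟩, h1, h2⟩, ⟨w, hw⟩⟩ ⟨⟨⟨i', b'⟩, h1', h2'⟩, ⟨w', hw'⟩⟩ h
    have h : i :: w = i' :: w' := congrArg Subtype.val h
    obtain ⟨rfl, rfl⟩ := List.cons.inj h
    obtain rfl := park_unique r.1 i b b' h1 h2 h1' h2' w hw hw'
    rfl
  · rintro ⟨w, hw⟩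
    cases w with
    | nil =>
      obtain ⟨q, hq⟩ := hr
      exfalso
      apply hq.not_ge
      intro x y hxy
      obtain rfl := parkW_nil r.1 hw x y hxy
      exact q.1.refl x
    | cons i w =>
      obtain ⟨b, h1, h2, h3⟩ := park_down r.1 i w hw
      exact ⟨⟨⟨⟨i, b⟩, h1, h2⟩, ⟨w, h3⟩⟩, rfl⟩

theorem ncs_eq_of_minimal {m : ℕ} (r : NCS m) (hr : ¬ ∃ q, q < r) (x y : Fin m) (h : r.1 x y) :
    x = y := by
  let z : NCS m := ⟨⊥, by
    intro a b c d h1 h2 h3 h4 h5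
    have : a = c := h4
    omega⟩
  have hz : z ≤ r := (bot_le : ⊥ ≤ r.1)
  rcases hz.lt_or_eq with h' | h'
  · exact absurd ⟨z, h'⟩ hr
  · rw [← h'] at h
    exact h

theorem ws_minimal {m : ℕ} (r : NCS m) (hr : ¬ ∃ q, q < r) : Nonempty (Unique (WS r)) := by
  have key := ncs_eq_of_minimal r hr
  have e : ∀ x, cnt (List.finRange m) (fun y => r.1 x y) = 1 := by
    intro x
    rw [← cnt_E_single x]
    exact cnt_congr _ fun y => ⟨fun h => (key x y h).symm, fun h => h ▸ r.1.refl x⟩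
  refine ⟨⟨⟨⟨[], ?_, ?_⟩⟩, ?_⟩⟩
  · intro x
    rw [e x]; simp [cnt]
  · intro x z hxz hlt
    exact absurd (key x z hxz) hlt.ne
  · rintro ⟨w, hw⟩
    apply Subtype.ext
    cases w with
    | nil => rfl
    | cons i w =>
      exfalso
      have := hw.1 i
      rw [e i] at this
      classical
      rw [cnt_cons, if_pos (r.1.refl i)] at this
      omega

instance ncsFinite (m : ℕ) : Finite (NCS m) := by
  have : Finite (Setoid (Fin m)) :=
    Finite.of_injective (fun r : Setoid (Fin m) => fun x y => r x y) (by
      intro r s h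
      ext x y
      exact iff_of_eq (congrFun (congrFun h x) y))
  infer_instance

theorem ws_equiv_mc {m : ℕ} (r : NCS m) : Nonempty (WS r ≃ MC r) := by
  induction r using WellFoundedLT.induction with
  | ind r ih =>
    by_cases hr : ∃ q, q < r
    · have e1 := Equiv.ofBijective _ (wStep_bijective r hr)
      have e2 := Equiv.ofBijective _ (mcStep_bijective r hr)
      have ih' : ∀ q : {q : NCS m // q ⋖ r}, Nonempty (WS q.1 ≃ MC q.1) := fun q => ih q.1 q.2.lt
      have f := fun q => (ih' q).some
      have e3 : (Σ q : QPair r.1, WS (splitN r q.1.1 q.1.2)) ≃ Σ q : {q : NCS m // q ⋖ r}, WS q.1 :=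
        Equiv.sigmaCongrLeft (β := fun q : {q : NCS m // q ⋖ r} => WS q.1) (coverEquiv r)
      exact ⟨e1.symm.trans (e3.trans ((Equiv.sigmaCongrRight f).trans e2))⟩
    · obtain ⟨u⟩ := ws_minimal r hr
      obtain ⟨v⟩ := mc_minimal r hr
      exact ⟨Equiv.ofUnique _ _⟩

instance ncsTop (m : ℕ) : OrderTop (NCS m) where
  top := ⟨⊤, fun _ _ _ _ _ _ _ _ _ => trivial⟩
  le_top r := (le_top : r.1 ≤ ⊤)

/-! ### The two ends -/

theorem nc_iff {m : ℕ} (C : Set (Set (Fin m))) (hC : Setoid.IsPartition C) :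
    Noncrossing C ↔ NCRel (Setoid.mkClasses C hC.2) := by
  have rel : ∀ B ∈ C, ∀ x ∈ B, ∀ y, Setoid.mkClasses C hC.2 x y ↔ y ∈ B := by
    intro B hB x hx y
    have := Setoid.eq_eqv_class_of_mem hC.2 hB hx
    conv_rhs => rw [this]
    exact ⟨fun h => Setoid.symm' _ h, fun h => Setoid.symm' _ h⟩
  constructor
  · intro h a b c d h1 h2 h3 h4 h5
    obtain ⟨B, ⟨hB, haB⟩, _⟩ := hC.2 a
    obtain ⟨B', ⟨hB', hbB⟩, _⟩ := hC.2 b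
    have := h B hB B' hB' a b c d h1 h2 h3 haB ((rel B hB a haB c).1 h4) hbB ((rel B' hB' b hbB d).1 h5)
    subst this
    exact (rel B hB a haB b).2 hbB
  · intro h B hB B' hB' a b c d h1 h2 h3 haB hcB hbB hdB
    have := h a b c d h1 h2 h3 ((rel B hB a haB c).2 hcB) ((rel B' hB' b hbB d).2 hdB)
    have hbB2 := (rel B hB a haB b).1 this
    exact (hC.2 b).unique ⟨hB, hbB2⟩ ⟨hB', hbB⟩

theorem refines_iff {m : ℕ} (p q : NC m) :
    Refines p q ↔ Setoid.mkClasses p.1 p.2.1.2 ≤ Setoid.mkClasses q.1 q.2.1.2 := by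
  have rel : ∀ (C : Set (Set (Fin m))) (hC : Setoid.IsPartition C), ∀ B ∈ C, ∀ x ∈ B, ∀ y,
      Setoid.mkClasses C hC.2 x y ↔ y ∈ B := by
    intro C hC B hB x hx y
    have := Setoid.eq_eqv_class_of_mem hC.2 hB hx
    conv_rhs => rw [this]
    exact ⟨fun h => Setoid.symm' _ h, fun h => Setoid.symm' _ h⟩
  constructor
  · intro h x y hxy
    obtain ⟨B, ⟨hB, hxB⟩, _⟩ := p.2.1.2 x
    obtain ⟨B', hB', hs⟩ := h B hB
    exact (rel q.1 q.2.1 B' hB' x (hs hxB) y).2 (hs ((rel p.1 p.2.1 B hB x hxB y).1 hxy))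
  · intro h B hB
    obtain ⟨x, hx⟩ := Setoid.nonempty_of_mem_partition p.2.1 hB
    obtain ⟨B', ⟨hB', hxB⟩, _⟩ := q.2.1.2 x
    exact ⟨B', hB', fun y hy => (rel q.1 q.2.1 B' hB' x hxB y).1 (h ((rel p.1 p.2.1 B hB x hx y).2 hy))⟩

/-- Noncrossing partitions as noncrossing equivalence relations. -/
noncomputable def ncIso (m : ℕ) : (Refines : NC m → NC m → Prop) ≃r ((· ≤ ·) : NCS m → NCS m → Prop) where
  toFun p := ⟨Setoid.mkClasses p.1 p.2.1.2, (nc_iff p.1 p.2.1).1 p.2.2⟩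
  invFun r := ⟨r.1.classes, Setoid.isPartition_classes r.1, by
    rw [nc_iff _ (Setoid.isPartition_classes r.1), Setoid.mkClasses_classes]; exact r.2⟩
  left_inv p := Subtype.ext (Setoid.classes_mkClasses p.1 p.2.1)
  right_inv r := Subtype.ext (Setoid.mkClasses_classes r.1)
  map_rel_iff' := by
    intro p q
    exact (refines_iff p q).symm

/-- Transport of maximal chains. -/
noncomputable def maxChainEquiv (m : ℕ) :
    {s : Set (NC m) // IsMaxChain Refines s} ≃ MC (⊤ : NCS m) :=
  Equiv.subtypeEquiv (Equiv.Set.congr (ncIso m).toEquiv) (by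
    intro s
    rw [mc_top_iff]
    constructor
    · intro h
      exact h.image (ncIso m)
    · intro h
      have h2 := h.image (ncIso m).symm
      have e : (ncIso m).symm '' (Equiv.Set.congr (ncIso m).toEquiv s) = s :=
        (ncIso m).toEquiv.symm_image_image s
      rwa [e] at h2)

theorem cnt_ofFn {m n : ℕ} (f : Fin n → Fin m) (p : Fin m → Prop) [DecidablePred p] :
    cnt (List.ofFn f) p = (Finset.univ.filter fun j => p (f j)).card := by
  rw [← cnt_E_card, List.ofFn_eq_map, cnt, cnt, List.countP_map]
  rfl

theorem parkW_top_iff (n : ℕ) (f : Fin n → Fin (n + 1)) :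
    ParkW (⊤ : NCS (n + 1)).1 (List.ofFn f) ↔
      ∀ k : ℕ, k < n → k + 1 ≤ (Finset.univ.filter fun j => (f j).val ≤ k).card := by
  classical
  have ht : ∀ x y, (⊤ : NCS (n + 1)).1 x y := fun _ _ => trivial
  have e1 : ∀ x : Fin (n + 1), cnt (List.finRange (n + 1))
      (fun y => (⊤ : NCS (n + 1)).1 x y ∧ y ≤ x) = x.val + 1 := by
    intro x
    rw [cnt_E_card]
    simp only [ht, true_and]
    have : (Finset.univ.filter fun y : Fin (n + 1) => y ≤ x) = Finset.Iic x := by ext; simp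
    rw [this, Fin.card_Iic]
  have e2 : ∀ x : Fin (n + 1), cnt (List.ofFn f)
      (fun y => (⊤ : NCS (n + 1)).1 x y ∧ y ≤ x) =
      (Finset.univ.filter fun j => (f j).val ≤ x.val).card := by
    intro x
    rw [cnt_ofFn]
    simp only [ht, true_and, Fin.le_def]
  constructor
  · intro h k hk
    have := h.2 ⟨k, by omega⟩ ⟨n, by omega⟩ (ht _ _) hk
    rw [e1, e2] at this
    exact this
  · intro h
    refine ⟨?_, ?_⟩
    · intro x
      rw [cnt_ofFn, cnt_E_card]
      simp [ht]
    · intro x z _ hlt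
      rw [e1, e2]
      exact h x.val (by omega)

theorem parking_equiv (n : ℕ) (hn : 0 < n) :
    Nonempty ({α : Fin n → ℕ // IsParkingFunction n α} ≃ WS (⊤ : NCS (n + 1))) := by
  classical
  let g : {α : Fin n → ℕ // IsParkingFunction n α} → Fin n → Fin (n + 1) := fun α j =>
    ⟨α.1 j - 1, by have := α.2.1 j; rw [Finset.mem_Icc] at this; omega⟩
  have hg : ∀ α, ParkW (⊤ : NCS (n + 1)).1 (List.ofFn (g α)) := by
    intro α
    rw [parkW_top_iff]
    intro k hk
    have := α.2.2 (k + 1) (by rw [Finset.mem_Icc]; omega)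
    refine this.trans (Finset.card_le_card ?_)
    intro j
    simp only [Finset.mem_filter, Finset.mem_univ, true_and, g]
    omega
  refine ⟨Equiv.ofBijective (fun α => ⟨List.ofFn (g α), hg α⟩) ⟨?_, ?_⟩⟩
  · intro α β h
    have h := List.ofFn_injective (congrArg Subtype.val h)
    apply Subtype.ext
    funext j
    have h1 : α.1 j - 1 = β.1 j - 1 := congrArg Fin.val (congrFun h j)
    have h2 := α.2.1 j
    have h3 := β.2.1 j
    rw [Finset.mem_Icc] at h2 h3
    omega
  · rintro ⟨w, hw⟩
    have hlen : w.length = n := by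
      have h1 := hw.1 0
      rw [cnt_E_card] at h1
      have ht : ∀ x y, (⊤ : NCS (n + 1)).1 x y := fun _ _ => trivial
      simpa [cnt, ht] using h1
    obtain ⟨f, rfl⟩ : ∃ f : Fin n → Fin (n + 1), w = List.ofFn f := by
      refine ⟨fun j => w.get (Fin.cast hlen.symm j), ?_⟩
      apply List.ext_get
      · simp [hlen]
      · intro k h1 h2
        simp
    have hp := (parkW_top_iff n f).1 hw
    have hall : ∀ j, (f j).val < n := by
      have h1 := hp (n - 1) (by omega)
      have h2 : (Finset.univ.filter fun j => (f j).val ≤ n - 1) = Finset.univ := by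
        apply Finset.eq_univ_of_card
        have h3 := Finset.card_filter_le (Finset.univ : Finset (Fin n)) (fun j => (f j).val ≤ n - 1)
        rw [Finset.card_univ, Fintype.card_fin] at h3
        rw [Fintype.card_fin]
        omega
      intro j
      have h4 := Finset.mem_univ j
      rw [← h2, Finset.mem_filter] at h4
      omega
    refine ⟨⟨fun j => (f j).val + 1, ?_, ?_⟩, ?_⟩
    · intro j
      have := hall j
      exact Finset.mem_Icc.2 ⟨Nat.succ_le_succ (Nat.zero_le _), this⟩
    · intro i hi
      rw [Finset.mem_Icc] at hi
      have h1 := hp (i - 1) (by omega)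
      have h2 : i ≤ (Finset.univ.filter fun j => (f j).val ≤ i - 1).card := by omega
      refine h2.trans (Finset.card_le_card ?_)
      intro j
      simp only [Finset.mem_filter, Finset.mem_univ, true_and]
      omega
    · apply Subtype.ext
      rfl

/-- For every positive integer `n`, there is a bijection between parking
functions of length `n` and maximal chains of the poset `NC_{n+1}` of noncrossing
partitions of `{1, …, n+1}` ordered by refinement. -/
theorem parkingFunctions_equiv_maxChains (n : ℕ) (hn : 0 < n) :
    Nonempty ({α : Fin n → ℕ // IsParkingFunction n α} ≃
      {s : Set (NC (n + 1)) // IsMaxChain Refines s}) := by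
  obtain ⟨e1⟩ := parking_equiv n hn
  obtain ⟨e2⟩ := ws_equiv_mc (⊤ : NCS (n + 1))
  exact ⟨e1.trans (e2.trans (maxChainEquiv (n + 1)).symm)⟩
end
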